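/- arXiv:2605.24255 — 7 statements merged into one kernel-verified Lean document; each statement's English description precedes it below -/
import Mathlib

section
/- For every l ≥ 1 and every T ∈ SYT((∞^l)), the filling U of (∞^l) defined by U_{1,1} = 1, U_{1,j} = T_{1,j−1} + 1 for all j ≥ 2, and U_{i,j} = T_{i,j} + 1 for all i ≥ 2 and j ≥ 1 is an infinite standard Young tableau of shape (∞^l) satisfying jdt(U) = T. In particular, jdt : SYT((∞^l)) → SYT((∞^l)) is surjective. -/
open scoped Classical

/-- A 0-based box `(i, j)` belongs to the infinite shape with `l` rows
(`l = ⊤` gives the shape `(∞^∞)`, `l = (l₀ : ℕ∞)` gives `(∞^l₀)`).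
Throughout, boxes are 0-based: the paper's box `(i, j)` (with row `i ≥ 1` and
column `j ≥ 1`) corresponds to `(i - 1, j - 1)`. -/
def Box (l : ℕ∞) (b : ℕ × ℕ) : Prop := (b.1 : ℕ∞) < l

/-- `T` is an infinite standard Young tableau of the shape given by `Box l`:
entries are positive integers on the shape (and the junk value `0` off the shape),
`T` is a bijection from the boxes of the shape onto the positive integers, and
`T` is strictly increasing along rows and columns. -/
structure IsSYT (l : ℕ∞) (T : ℕ × ℕ → ℕ) : Prop where
  zero_outside : ∀ b : ℕ × ℕ, ¬ Box l b → T b = 0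
  pos : ∀ b : ℕ × ℕ, Box l b → 0 < T b
  inj : ∀ b c : ℕ × ℕ, Box l b → Box l c → T b = T c → b = c
  surj : ∀ n : ℕ, 0 < n → ∃ b : ℕ × ℕ, Box l b ∧ T b = n
  row_lt : ∀ b : ℕ × ℕ, Box l b → T b < T (b.1, b.2 + 1)
  col_lt : ∀ b : ℕ × ℕ, Box l (b.1 + 1, b.2) → T b < T (b.1 + 1, b.2)

/-- The sliding path of the filling `T` inside the set `D` of boxes, started at the
box `c`: at each step the empty box moves to whichever of the boxes directly below
or directly to the right (among those belonging to `D`) carries the smaller entry;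
if neither belongs to `D`, the path stays put (it has terminated). -/
noncomputable def slideFrom (D : ℕ × ℕ → Prop) (T : ℕ × ℕ → ℕ) (c : ℕ × ℕ) : ℕ → ℕ × ℕ
  | 0 => c
  | n + 1 =>
      let b := slideFrom D T c n
      if D (b.1 + 1, b.2) ∧ D (b.1, b.2 + 1) then
        (if T (b.1 + 1, b.2) < T (b.1, b.2 + 1) then (b.1 + 1, b.2) else (b.1, b.2 + 1))
      else if D (b.1 + 1, b.2) then (b.1 + 1, b.2)
      else if D (b.1, b.2 + 1) then (b.1, b.2 + 1)
      else b

/-- The sliding path `p(T)`, 0-indexed: `slide D T n` is the paper's `p_{n+1}(T)`;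
it lies on the antidiagonal `i + j = n` as long as the path has not terminated. -/
noncomputable def slide (D : ℕ × ℕ → Prop) (T : ℕ × ℕ → ℕ) : ℕ → ℕ × ℕ :=
  slideFrom D T (0, 0)

/-- Jeu de taquin on the set of boxes `D`: the entry `1` in the box `(0,0)` is
deleted, entries slide backwards along the sliding path, and every entry is
decremented by `1`.  A box `b` lies on the sliding path iff
`slide D T (b.1 + b.2) = b`; if moreover the path terminates at `b` (which is only
possible for finite tableaux) the box `b` is vacated (junk value `0`). -/
noncomputable def jdt (D : ℕ × ℕ → Prop) (T : ℕ × ℕ → ℕ) : ℕ × ℕ → ℕ := fun b =>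
  if slide D T (b.1 + b.2) = b then
    (if slide D T (b.1 + b.2 + 1) = b then 0
     else T (slide D T (b.1 + b.2 + 1)) - 1)
  else T b - 1

/-- The explicit preimage of `T` under jeu de taquin: `U (0,0) = 1`,
`U (0, j) = T (0, j-1) + 1` for `j ≥ 1` (paper: first row, columns `j ≥ 2`), and
`U b = T b + 1` on every lower row (paper: rows `i ≥ 2`). -/
noncomputable def U0 (l : ℕ∞) (T : ℕ × ℕ → ℕ) : ℕ × ℕ → ℕ := fun b =>
  if Box l b then
    (if b.1 = 0 then (if b.2 = 0 then 1 else T (0, b.2 - 1) + 1) else T b + 1)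
  else 0

theorem box_iff (l : ℕ) (a b : ℕ) : Box (l : ℕ∞) (a, b) ↔ a < l := by
  simp [Box]

theorem U0_zz (l : ℕ) (hl : 1 ≤ l) (T : ℕ × ℕ → ℕ) : U0 (l : ℕ∞) T (0, 0) = 1 := by
  have : Box (l : ℕ∞) (0, 0) := (box_iff _ _ _).2 hl
  simp [U0, this]

theorem U0_zs (l : ℕ) (hl : 1 ≤ l) (T : ℕ × ℕ → ℕ) (j : ℕ) :
    U0 (l : ℕ∞) T (0, j + 1) = T (0, j) + 1 := by
  have : Box (l : ℕ∞) (0, j + 1) := (box_iff _ _ _).2 hl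
  simp [U0, this]

theorem U0_s (l : ℕ) (T : ℕ × ℕ → ℕ) (i j : ℕ) (h : i + 1 < l) :
    U0 (l : ℕ∞) T (i + 1, j) = T (i + 1, j) + 1 := by
  have : Box (l : ℕ∞) (i + 1, j) := (box_iff _ _ _).2 h
  simp [U0, this]

theorem U0_out (l : ℕ) (T : ℕ × ℕ → ℕ) (i j : ℕ) (h : ¬ i < l) :
    U0 (l : ℕ∞) T (i, j) = 0 := by
  have : ¬ Box (l : ℕ∞) (i, j) := fun h' => h ((box_iff _ _ _).1 h')
  simp [U0, this]

theorem U0_syt (l : ℕ) (hl : 1 ≤ l) (T : ℕ × ℕ → ℕ) (hT : IsSYT (l : ℕ∞) T) :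
    IsSYT (l : ℕ∞) (U0 (l : ℕ∞) T) := by
  have hpos : ∀ i j, i < l → 0 < T (i, j) := fun i j h => hT.pos _ ((box_iff _ _ _).2 h)
  have hinj : ∀ i j i' j', i < l → i' < l → T (i, j) = T (i', j') → i = i' ∧ j = j' := by
    intro i j i' j' h h' e
    simpa using hT.inj _ _ ((box_iff _ _ _).2 h) ((box_iff _ _ _).2 h') e
  have hrow : ∀ i j, i < l → T (i, j) < T (i, j + 1) :=
    fun i j h => hT.row_lt (i, j) ((box_iff _ _ _).2 h)
  have hcol : ∀ i j, i + 1 < l → T (i, j) < T (i + 1, j) :=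
    fun i j h => hT.col_lt (i, j) ((box_iff _ _ _).2 h)
  refine ⟨?_, ?_, ?_, ?_, ?_, ?_⟩
  · rintro ⟨i, j⟩ h
    exact U0_out l T i j (fun h' => h ((box_iff _ _ _).2 h'))
  · rintro ⟨_ | i, _ | j⟩ h <;> rw [box_iff] at h
    · rw [U0_zz l hl]; omega
    · rw [U0_zs l hl]; omega
    · rw [U0_s l T _ _ h]; omega
    · rw [U0_s l T _ _ h]; omega
  · rintro ⟨i, j⟩ ⟨i', j'⟩ h h' e
    rw [box_iff] at h h'
    rw [Prod.mk.injEq]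
    rcases i with _ | i
    · rcases i' with _ | i'
      · rcases j with _ | j <;> rcases j' with _ | j'
        · simp
        · rw [U0_zz l hl, U0_zs l hl] at e
          have := hpos 0 j' h'; omega
        · rw [U0_zz l hl, U0_zs l hl] at e
          have := hpos 0 j h'; omega
        · rw [U0_zs l hl, U0_zs l hl] at e
          have := hinj 0 j 0 j' h h' (by omega); omega
      · rw [U0_s l T _ _ h'] at e
        rcases j with _ | j
        · rw [U0_zz l hl] at e
          have := hpos _ j' h'; omega
        · rw [U0_zs l hl] at e
          have := hinj _ _ _ _ h h' (Nat.succ.inj e); omega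
    · rw [U0_s l T _ _ h] at e
      rcases i' with _ | i'
      · rcases j' with _ | j'
        · rw [U0_zz l hl] at e
          have := hpos _ j h; omega
        · rw [U0_zs l hl] at e
          have := hinj _ _ _ _ h h' (Nat.succ.inj e); omega
      · rw [U0_s l T _ _ h'] at e
        exact hinj _ _ _ _ h h' (Nat.succ.inj e)
  · intro n hn
    rcases n with _ | _ | n
    · omega
    · exact ⟨(0, 0), (box_iff _ _ _).2 hl, U0_zz l hl T⟩
    · obtain ⟨⟨i, j⟩, h, e⟩ := hT.surj (n + 1) (by omega)
      rw [box_iff] at h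
      rcases i with _ | i
      · exact ⟨(0, j + 1), (box_iff _ _ _).2 hl, by rw [U0_zs l hl, e]⟩
      · exact ⟨(i + 1, j), (box_iff _ _ _).2 h, by rw [U0_s l T _ _ h, e]⟩
  · rintro ⟨i, j⟩ h
    rw [box_iff] at h
    dsimp only
    rcases i with _ | i
    · rw [U0_zs l hl]
      rcases j with _ | j
      · rw [U0_zz l hl]
        have := hpos 0 0 h; omega
      · rw [U0_zs l hl]
        have := hrow 0 j h; omega
    · rw [U0_s l T _ _ h, U0_s l T _ _ h]
      have := hrow _ j h; omega
  · rintro ⟨i, j⟩ h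
    rw [box_iff] at h
    dsimp only at h ⊢
    rw [U0_s l T _ _ h]
    have h1 := hcol i j h
    rcases i with _ | i
    · rcases j with _ | j
      · rw [U0_zz l hl]; omega
      · rw [U0_zs l hl]
        have := hrow 0 j hl; omega
    · rw [U0_s l T _ _ (by omega)]; omega

theorem slide_U0 (l : ℕ) (hl : 1 ≤ l) (T : ℕ × ℕ → ℕ) (hT : IsSYT (l : ℕ∞) T) (n : ℕ) :
    slide (Box (l : ℕ∞)) (U0 (l : ℕ∞) T) n = (0, n) := by
  induction n with
  | zero => rfl
  | succ n ih =>
    unfold slide at ih ⊢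
    rw [slideFrom, ih]
    have hb : Box (l : ℕ∞) (0, n + 1) := (box_iff _ _ _).2 hl
    dsimp only
    by_cases h : Box (l : ℕ∞) (0 + 1, n)
    · have h' := (box_iff _ _ _).1 h
      have h1 := hT.col_lt (0, n) h
      rw [if_pos ⟨h, hb⟩, U0_s l T _ _ h', U0_zs l hl, if_neg (by dsimp only at h1; omega)]
    · rw [if_neg (fun h' => h h'.1), if_neg h, if_pos hb]

theorem jdt_U0 (l : ℕ) (hl : 1 ≤ l) (T : ℕ × ℕ → ℕ) (hT : IsSYT (l : ℕ∞) T) :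
    jdt (Box (l : ℕ∞)) (U0 (l : ℕ∞) T) = T := by
  funext ⟨i, j⟩
  unfold jdt
  simp only [slide_U0 l hl T hT]
  rcases i with _ | i
  · rw [if_pos (by simp), if_neg (by simp)]
    simp [U0_zs l hl]
  · rw [if_neg (by simp)]
    by_cases h : i + 1 < l
    · rw [U0_s l T _ _ h]; simp
    · rw [U0_out l T _ _ h, hT.zero_outside _ (fun h' => h ((box_iff _ _ _).1 h'))]

/-- For every `l ≥ 1` and `T ∈ SYT((∞^l))`, the explicit filling `U0 l T` is an
infinite standard Young tableau of shape `(∞^l)` with `jdt (U0 l T) = T`; in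
particular `jdt : SYT((∞^l)) → SYT((∞^l))` is surjective. -/
theorem stmt_0 (l : ℕ) (hl : 1 ≤ l) (T : ℕ × ℕ → ℕ) (hT : IsSYT (l : ℕ∞) T) :
    (IsSYT (l : ℕ∞) (U0 (l : ℕ∞) T) ∧ jdt (Box (l : ℕ∞)) (U0 (l : ℕ∞) T) = T) ∧
    (∀ T' : ℕ × ℕ → ℕ, IsSYT (l : ℕ∞) T' →
      ∃ U : ℕ × ℕ → ℕ, IsSYT (l : ℕ∞) U ∧ jdt (Box (l : ℕ∞)) U = T') := by
  exact ⟨⟨U0_syt l hl T hT, jdt_U0 l hl T hT⟩,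
    fun T' hT' => ⟨_, U0_syt l hl T' hT', jdt_U0 l hl T' hT'⟩⟩
end

section
/- For every l ≥ 1 and every T ∈ SYT((∞^l)), the sliding path p(T) eventually becomes horizontal: there exist a row index i_0 with 1 ≤ i_0 ≤ l and N ∈ ℕ such that p_n(T) lies in row i_0 for all n ≥ N. -/
open scoped Classical

theorem slide_box_aux (l : ℕ) (hl : 1 ≤ l) (T : ℕ × ℕ → ℕ) (n : ℕ) :
    (slide (Box (l : ℕ∞)) T n).1 < l := by
  induction n with
  | zero => simpa [slide, slideFrom] using (by omega : 0 < l)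
  | succ n ih =>
    unfold slide at ih ⊢
    simp only [slideFrom, Box, Nat.cast_lt]
    split_ifs <;> simp_all

theorem slide_mono_aux (l : ℕ) (T : ℕ × ℕ → ℕ) :
    Monotone (fun n => (slide (Box (l : ℕ∞)) T n).1) := by
  refine monotone_nat_of_le_succ (fun n => ?_)
  simp only [slide, slideFrom]
  split_ifs <;> simp

/-- For every `l ≥ 1` and `T ∈ SYT((∞^l))`, the sliding path of `T` eventually
becomes horizontal: it eventually stays in a fixed (0-based) row `i₀ < l`. -/
theorem stmt_1 (l : ℕ) (hl : 1 ≤ l) (T : ℕ × ℕ → ℕ) (hT : IsSYT (l : ℕ∞) T) :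
    ∃ i₀ : ℕ, i₀ < l ∧ ∃ N : ℕ, ∀ n : ℕ, N ≤ n → (slide (Box (l : ℕ∞)) T n).1 = i₀ := by
  obtain ⟨N, hN⟩ := wellFoundedGT_iff_monotone_chain_condition.mp
    (inferInstance : WellFoundedGT (Fin l))
    ⟨fun n => ⟨(slide (Box (l : ℕ∞)) T n).1, slide_box_aux l hl T n⟩,
      fun a b hab => slide_mono_aux l T hab⟩
  refine ⟨_, slide_box_aux l hl T N, N, fun n hn => ?_⟩
  exact (congrArg Fin.val (hN n hn)).symm
end

section
/- Let μ be the infinite shape (∞^l) for some l ≥ 1 or the infinite shape (∞^∞), let T ∈ SYT(μ), and suppose U, V ∈ SYT(μ) satisfy jdt(U) = jdt(V) = T. Then U = V if and only if p_n(U) = p_n(V) for all n ∈ ℕ, i.e., U and V have the same sliding paths. -/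
open scoped Classical

theorem slide_inv (l : ℕ∞) (h0 : Box l (0,0)) (U : ℕ × ℕ → ℕ) (n : ℕ) :
    Box l (slide (Box l) U n) ∧ (slide (Box l) U n).1 + (slide (Box l) U n).2 = n := by
  induction n with
  | zero => exact ⟨h0, rfl⟩
  | succ n ih =>
    obtain ⟨h1, h2⟩ := ih
    have e : slide (Box l) U (n+1) = ((slide (Box l) U n).1 + 1, (slide (Box l) U n).2) ∧
        Box l ((slide (Box l) U n).1 + 1, (slide (Box l) U n).2) ∨
        slide (Box l) U (n+1) = ((slide (Box l) U n).1, (slide (Box l) U n).2 + 1) := by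
      have h3 : Box l ((slide (Box l) U n).1, (slide (Box l) U n).2 + 1) := h1
      unfold slide at h3 ⊢
      rw [slideFrom]
      split_ifs <;> simp_all
    rcases e with ⟨e, hb⟩ | e
    · rw [e]; exact ⟨hb, by dsimp only; omega⟩
    · rw [e]; exact ⟨h1, by dsimp only; omega⟩

theorem syt_origin (l : ℕ∞) (U : ℕ × ℕ → ℕ) (hU : IsSYT l U) : U (0,0) = 1 := by
  obtain ⟨⟨i, j⟩, hb, h1⟩ := hU.surj 1 one_pos
  rcases j with _ | j
  · rcases i with _ | i
    · exact h1
    · have h2 := hU.col_lt (i, 0) hb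
      have h3 : Box l (i, 0) := lt_of_le_of_lt (by simp) hb
      have h4 := hU.pos _ h3
      dsimp only at h2
      omega
  · have hb' : Box l (i, j) := hb
    have h2 := hU.row_lt (i, j) hb'
    have h4 := hU.pos _ hb'
    dsimp only at h2
    omega

theorem stmt_2 (l : ℕ∞) (hl : l = ⊤ ∨ ∃ l₀ : ℕ, 1 ≤ l₀ ∧ l = (l₀ : ℕ∞))
    (T U V : ℕ × ℕ → ℕ) (hT : IsSYT l T) (hU : IsSYT l U) (hV : IsSYT l V)
    (hUT : jdt (Box l) U = T) (hVT : jdt (Box l) V = T) :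
    U = V ↔ ∀ n : ℕ, slide (Box l) U n = slide (Box l) V n := by
  constructor
  · rintro rfl n; rfl
  intro hp
  have h0 : Box l (0,0) := by
    unfold Box
    rcases hl with rfl | ⟨k, hk, rfl⟩
    · simp
    · exact_mod_cast hk
  have hj : jdt (Box l) U = jdt (Box l) V := hUT.trans hVT.symm
  funext b
  by_cases hb : Box l b
  swap
  · rw [hU.zero_outside b hb, hV.zero_outside b hb]
  have pU := hU.pos b hb
  have pV := hV.pos b hb
  by_cases hs : slide (Box l) U (b.1 + b.2) = b
  · rcases hn : b.1 + b.2 with _ | n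
    · have : b = (0,0) := by ext <;> simp <;> omega
      rw [this, syt_origin l U hU, syt_origin l V hV]
    · rw [hn] at hs
      obtain ⟨h1, h2⟩ := slide_inv l h0 U n
      have h := congrFun hj (slide (Box l) U n)
      unfold jdt at h
      rw [h2] at h
      rw [← hp n, ← hp (n+1), hs, if_pos rfl, if_pos rfl] at h
      have hne : b ≠ slide (Box l) U n := by
        intro e; rw [← e] at h2; omega
      rw [if_neg hne, if_neg hne] at h
      omega
  · have h := congrFun hj b
    unfold jdt at h
    rw [← hp, if_neg hs, if_neg hs] at h
    omega
end

section
/- Let μ be the infinite shape (∞^l) for some l ≥ 1 or the infinite shape (∞^∞), let T ∈ SYT(μ), and suppose U, V ∈ SYT(μ) satisfy jdt(U) = jdt(V) = T. If p_n(U) ≠ p_n(V) for some n ∈ ℕ, then p_m(U) ≠ p_m(V) for every m ≥ n (sliding paths of distinct preimages never re-merge). -/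
open scoped Classical

theorem aux_step (l : ℕ∞) (U : ℕ × ℕ → ℕ) (n : ℕ) (hB : Box l (slide (Box l) U n)) :
    (slide (Box l) U (n+1) = ((slide (Box l) U n).1 + 1, (slide (Box l) U n).2) ∨
      slide (Box l) U (n+1) = ((slide (Box l) U n).1, (slide (Box l) U n).2 + 1)) ∧
    Box l (slide (Box l) U (n+1)) := by
  have h : slide (Box l) U (n+1) = (let b := slide (Box l) U n
      if Box l (b.1 + 1, b.2) ∧ Box l (b.1, b.2 + 1) then
        (if U (b.1 + 1, b.2) < U (b.1, b.2 + 1) then (b.1 + 1, b.2) else (b.1, b.2 + 1))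
      else if Box l (b.1 + 1, b.2) then (b.1 + 1, b.2)
      else if Box l (b.1, b.2 + 1) then (b.1, b.2 + 1)
      else b) := rfl
  have hB' : Box l ((slide (Box l) U n).1, (slide (Box l) U n).2 + 1) := hB
  rw [h]
  dsimp only
  split_ifs <;> simp_all

theorem aux_inv (l : ℕ∞) (h0 : Box l (0, 0)) (U : ℕ × ℕ → ℕ) (n : ℕ) :
    (slide (Box l) U n).1 + (slide (Box l) U n).2 = n ∧ Box l (slide (Box l) U n) := by
  induction n with
  | zero => exact ⟨rfl, h0⟩
  | succ n ih =>
    obtain ⟨h1, h2⟩ := aux_step l U n ih.2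
    refine ⟨?_, h2⟩
    rcases h1 with h1 | h1 <;> rw [h1] <;> dsimp only <;> omega

theorem aux_jdt_on (l : ℕ∞) (h0 : Box l (0, 0)) (U : ℕ × ℕ → ℕ) (n : ℕ) :
    jdt (Box l) U (slide (Box l) U n) = U (slide (Box l) U (n+1)) - 1 := by
  have h1 := (aux_inv l h0 U n).1
  have h2 := (aux_inv l h0 U (n+1)).1
  unfold jdt
  rw [h1, if_pos rfl, if_neg]
  intro h
  rw [h] at h2
  omega

theorem aux_jdt_off (l : ℕ∞) (U : ℕ × ℕ → ℕ) (b : ℕ × ℕ)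
    (hb : slide (Box l) U (b.1 + b.2) ≠ b) : jdt (Box l) U b = U b - 1 := by
  unfold jdt
  rw [if_neg hb]

theorem aux_lt (l : ℕ∞) (h0 : Box l (0, 0)) (T U V : ℕ × ℕ → ℕ) (hU : IsSYT l U)
    (hUT : jdt (Box l) U = T) (k : ℕ)
    (hne : slide (Box l) U k ≠ slide (Box l) V k)
    (he : slide (Box l) U (k+1) = slide (Box l) V (k+1)) :
    T (slide (Box l) V k) < T (slide (Box l) U k) := by
  have hV := aux_inv l h0 V k
  have hs := aux_step l V k hV.2
  have h1 := aux_jdt_on l h0 U k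
  have h2 := aux_jdt_off l U (slide (Box l) V k) (by rw [hV.1]; exact hne)
  have hp := hU.pos _ hV.2
  have hlt : U (slide (Box l) V k) < U (slide (Box l) V (k+1)) := by
    obtain ⟨h | h, hb⟩ := hs
    · rw [h] at hb ⊢
      exact hU.col_lt _ hb
    · rw [h]
      exact hU.row_lt _ hV.2
  rw [← hUT, h1, h2, he]
  omega

/-- Let `μ` be `(∞^l)` for some `l ≥ 1` or `(∞^∞)` and let `U, V` be preimages of
`T ∈ SYT(μ)` under jeu de taquin.  If the sliding paths of `U` and `V` differ at
some index `n`, then they differ at every index `m ≥ n`. -/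
theorem stmt_3 (l : ℕ∞) (hl : l = ⊤ ∨ ∃ l₀ : ℕ, 1 ≤ l₀ ∧ l = (l₀ : ℕ∞))
    (T U V : ℕ × ℕ → ℕ) (hT : IsSYT l T) (hU : IsSYT l U) (hV : IsSYT l V)
    (hUT : jdt (Box l) U = T) (hVT : jdt (Box l) V = T)
    (n : ℕ) (hn : slide (Box l) U n ≠ slide (Box l) V n) :
    ∀ m : ℕ, n ≤ m → slide (Box l) U m ≠ slide (Box l) V m := by
  have h0 : Box l (0, 0) := by
    unfold Box
    rcases hl with rfl | ⟨l₀, h, rfl⟩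
    · simp
    · exact_mod_cast h
  intro m hm
  induction m, hm using Nat.le_induction with
  | base => exact hn
  | succ k _ ih =>
    intro he
    have h1 := aux_lt l h0 T U V hU hUT k ih he
    have h2 := aux_lt l h0 T V U hV hVT k ih.symm he.symm
    omega
end

section
/- Let l, n ∈ ℕ, T ∈ SYT((∞^l)), U ∈ SYT((∞^l)) with jdt(U) = T, and suppose p_n(U) = (i,j). Then: (a) if the entry T_{i,j} is dominated, then p_{n+1}(U) = (i+1, j); and (b) if the entry T_{i+1, j−1} is not dominated (with the convention that entries in boxes outside the shape are 0), then p_{n+1}(U) = (i, j+1). -/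
open scoped Classical

/-- Extension of a 0-based filling to boxes indexed by `ℤ × ℤ`: value `0` outside. -/
noncomputable def entE (T : ℕ × ℕ → ℕ) (b : ℤ × ℤ) : ℕ :=
  if 0 ≤ b.1 ∧ 0 ≤ b.2 then T (b.1.toNat, b.2.toNat) else 0

/-- The entry of `T` in the (0-based, `ℤ`-indexed) box `b` is dominated:
`T b < T (b.1 - 1, b.2 + 1)`, entries in nonexistent boxes counting as `0`. -/
def Dominated (T : ℕ × ℕ → ℕ) (b : ℤ × ℤ) : Prop :=
  entE T b < entE T (b.1 - 1, b.2 + 1)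

theorem slide_step_aux (l : ℕ) (hl : 1 ≤ l) (U : ℕ × ℕ → ℕ) (n : ℕ) :
    (slide (Box (l : ℕ∞)) U n).1 < l ∧
    (slide (Box (l : ℕ∞)) U n).1 + (slide (Box (l : ℕ∞)) U n).2 = n ∧
    ((slide (Box (l : ℕ∞)) U (n+1) =
        ((slide (Box (l : ℕ∞)) U n).1 + 1, (slide (Box (l : ℕ∞)) U n).2) ∧
        (slide (Box (l : ℕ∞)) U n).1 + 1 < l) ∨
      slide (Box (l : ℕ∞)) U (n+1) =
        ((slide (Box (l : ℕ∞)) U n).1, (slide (Box (l : ℕ∞)) U n).2 + 1)) := by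
  have step : ∀ n, (slide (Box (l : ℕ∞)) U n).1 < l →
    ((slide (Box (l : ℕ∞)) U (n+1) =
        ((slide (Box (l : ℕ∞)) U n).1 + 1, (slide (Box (l : ℕ∞)) U n).2) ∧
        (slide (Box (l : ℕ∞)) U n).1 + 1 < l) ∨
      slide (Box (l : ℕ∞)) U (n+1) =
        ((slide (Box (l : ℕ∞)) U n).1, (slide (Box (l : ℕ∞)) U n).2 + 1)) := by
    intro n h
    have e : slide (Box (l : ℕ∞)) U (n+1) = slideFrom (Box (l : ℕ∞)) U (0,0) (n+1) := rfl
    rw [slideFrom] at e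
    have e0 : slideFrom (Box (l : ℕ∞)) U (0,0) n = slide (Box (l : ℕ∞)) U n := rfl
    rw [e0] at e
    clear e0
    generalize slide (Box (l : ℕ∞)) U n = b at *
    have hb : ∀ x y : ℕ, Box (l : ℕ∞) (x, y) ↔ x < l := by
      intro x y
      simp [Box]
    simp only [hb, h, and_true, if_true] at e
    split_ifs at e with h1 h2
    · exact Or.inl ⟨e, h1⟩
    · exact Or.inr e
    · exact Or.inr e
  have inv : ∀ n, (slide (Box (l : ℕ∞)) U n).1 < l ∧
      (slide (Box (l : ℕ∞)) U n).1 + (slide (Box (l : ℕ∞)) U n).2 = n := by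
    intro n
    induction n with
    | zero => exact ⟨by simp [slide, slideFrom]; omega, by simp [slide, slideFrom]⟩
    | succ n ih =>
      rcases step n ih.1 with ⟨h, h'⟩ | h
      · rw [h]; dsimp only; omega
      · rw [h]; dsimp only; omega
  exact ⟨(inv n).1, (inv n).2, step n (inv n).1⟩

/-- Let `U` be a jeu de taquin preimage of `T ∈ SYT((∞^l))` and suppose the sliding
path of `U` passes through the (0-based) box `(i, j)`.  (a) If the entry `T (i,j)` is
dominated, the path next moves down to `(i+1, j)`; (b) if the entry of `T` in the
(possibly nonexistent) box `(i+1, j-1)` is not dominated, the path next moves right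
to `(i, j+1)`. -/
theorem stmt_4 (l : ℕ) (hl : 1 ≤ l) (n : ℕ) (T U : ℕ × ℕ → ℕ)
    (hT : IsSYT (l : ℕ∞) T) (hU : IsSYT (l : ℕ∞) U)
    (hUT : jdt (Box (l : ℕ∞)) U = T) (i j : ℕ)
    (hp : slide (Box (l : ℕ∞)) U n = (i, j)) :
    (Dominated T ((i : ℤ), (j : ℤ)) →
      slide (Box (l : ℕ∞)) U (n + 1) = (i + 1, j)) ∧
    (¬ Dominated T ((i : ℤ) + 1, (j : ℤ) - 1) →
      slide (Box (l : ℕ∞)) U (n + 1) = (i, j + 1)) := by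
  obtain ⟨h1, h2, h3⟩ := slide_step_aux l hl U n
  rw [hp] at h1 h2 h3
  dsimp only at h1 h2 h3
  have hb : ∀ x y : ℕ, Box (l : ℕ∞) (x, y) ↔ x < l := by
    intro x y
    simp [Box]
  have hoff : ∀ x y : ℕ, x + y = n → x ≠ i → T (x, y) = U (x, y) - 1 := by
    intro x y hxy hx
    rw [← hUT]
    simp only [jdt]
    rw [hxy, hp, if_neg]
    intro h
    exact hx (Prod.mk.inj h).1.symm
  have hon : T (i, j) = U (slide (Box (l : ℕ∞)) U (n + 1)) - 1 := by
    rw [← hUT]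
    simp only [jdt]
    rw [h2, hp, if_pos rfl, if_neg]
    rcases h3 with ⟨h, _⟩ | h <;> rw [h] <;> simp
  constructor
  · intro hd
    rcases h3 with ⟨h, _⟩ | h
    · exact h
    exfalso
    rw [h] at hon
    rcases i with _ | i
    · simp [Dominated, entE] at hd
    · have hd' : T (i + 1, j) < T (i, j + 1) := by
        have e : ((i + 1 : ℕ) : ℤ) - 1 = (i : ℤ) := by push_cast; ring
        have e' : (j : ℤ) + 1 = ((j + 1 : ℕ) : ℤ) := by push_cast; ring
        simp only [Dominated, entE, e, e', Int.toNat_natCast, Int.natCast_nonneg, and_self,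
          if_true] at hd
        exact hd
      have a := hoff i (j + 1) (by omega) (by omega)
      have c := hU.col_lt (i, j + 1) ((hb _ _).2 h1)
      dsimp only at c
      omega
  · intro hd
    rcases h3 with ⟨h, hlt⟩ | h
    swap
    · exact h
    exfalso
    rw [h] at hon
    have hpos := hT.pos (i, j) ((hb _ _).2 h1)
    have e : (i : ℤ) + 1 = ((i + 1 : ℕ) : ℤ) := by push_cast; ring
    have e1 : ((i + 1 : ℕ) : ℤ) - 1 = (i : ℤ) := by push_cast; ring
    have e2 : (j : ℤ) - 1 + 1 = (j : ℤ) := by ring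
    simp only [Dominated, entE, e, e1, e2, Int.toNat_natCast, Int.natCast_nonneg, and_self,
      if_true, true_and] at hd
    rcases j with _ | j
    · simp at hd
      omega
    · have e3 : ((j + 1 : ℕ) : ℤ) - 1 = (j : ℤ) := by push_cast; ring
      simp only [e3, Int.toNat_natCast, Int.natCast_nonneg, if_true] at hd
      have a := hoff (i + 1) j (by omega) (by omega)
      have c := hU.row_lt (i + 1, j) ((hb _ _).2 hlt)
      have c' := hU.pos (i + 1, j) ((hb _ _).2 hlt)
      dsimp only at c
      omega
end

section
/- Let μ be the infinite shape (∞^l) for some l ≥ 1 or the infinite shape (∞^∞), let T ∈ SYT(μ), and suppose T is k-periodic for some k ≥ 1, i.e., jdt^k(T) = T. Then T_{i,j} ≤ k(i + j − 2) + 1 for every box (i,j) of μ. Moreover, if μ = (∞^l), then k ≥ l. -/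
open scoped Classical

lemma step_cases (l : ℕ∞) (T : ℕ × ℕ → ℕ) (n : ℕ) (hb : Box l (slide (Box l) T n)) :
    (slide (Box l) T (n+1) = ((slide (Box l) T n).1 + 1, (slide (Box l) T n).2) ∧
      Box l ((slide (Box l) T n).1 + 1, (slide (Box l) T n).2) ∧
      T ((slide (Box l) T n).1 + 1, (slide (Box l) T n).2)
        < T ((slide (Box l) T n).1, (slide (Box l) T n).2 + 1)) ∨
    (slide (Box l) T (n+1) = ((slide (Box l) T n).1, (slide (Box l) T n).2 + 1) ∧
      (Box l ((slide (Box l) T n).1 + 1, (slide (Box l) T n).2) →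
      T ((slide (Box l) T n).1, (slide (Box l) T n).2 + 1)
        ≤ T ((slide (Box l) T n).1 + 1, (slide (Box l) T n).2))) := by
  have hr : Box l ((slide (Box l) T n).1, (slide (Box l) T n).2 + 1) := hb
  have e : slide (Box l) T (n+1) =
      (let b := slide (Box l) T n
      if Box l (b.1 + 1, b.2) ∧ Box l (b.1, b.2 + 1) then
        (if T (b.1 + 1, b.2) < T (b.1, b.2 + 1) then (b.1 + 1, b.2) else (b.1, b.2 + 1))
      else if Box l (b.1 + 1, b.2) then (b.1 + 1, b.2)
      else if Box l (b.1, b.2 + 1) then (b.1, b.2 + 1)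
      else b) := rfl
  rw [e]
  by_cases h1 : Box l ((slide (Box l) T n).1 + 1, (slide (Box l) T n).2)
  · by_cases h2 : T ((slide (Box l) T n).1 + 1, (slide (Box l) T n).2)
        < T ((slide (Box l) T n).1, (slide (Box l) T n).2 + 1)
    · left; simp [h1, h2, hr]
    · right; simp [h1, h2, hr]; omega
  · right; simp [h1, hr]

lemma slide_box (l : ℕ∞) (h0 : Box l (0,0)) (T : ℕ × ℕ → ℕ) (n : ℕ) :
    Box l (slide (Box l) T n) ∧ (slide (Box l) T n).1 + (slide (Box l) T n).2 = n := by
  induction n with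
  | zero => exact ⟨h0, rfl⟩
  | succ n ih =>
    obtain ⟨hb, hs⟩ := ih
    rcases step_cases l T n hb with ⟨e, h1, _⟩ | ⟨e, _⟩
    · rw [e]; exact ⟨h1, by simp only; omega⟩
    · rw [e]; exact ⟨hb, by simp only; omega⟩

lemma slide_lt {l : ℕ∞} {T : ℕ × ℕ → ℕ} (hT : IsSYT l T) (h0 : Box l (0,0)) (n : ℕ) :
    T (slide (Box l) T n) < T (slide (Box l) T (n+1)) := by
  obtain ⟨hb, hs⟩ := slide_box l h0 T n
  rcases step_cases l T n hb with ⟨e, h1, _⟩ | ⟨e, _⟩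
  · rw [e]; exact hT.col_lt _ h1
  · rw [e]; exact hT.row_lt _ hb

lemma jdt_on {l : ℕ∞} {T : ℕ × ℕ → ℕ} (h0 : Box l (0,0)) (b : ℕ × ℕ)
    (h : slide (Box l) T (b.1+b.2) = b) :
    jdt (Box l) T b = T (slide (Box l) T (b.1+b.2+1)) - 1 := by
  have h2 : slide (Box l) T (b.1+b.2+1) ≠ b := by
    intro h3
    have := (slide_box l h0 T (b.1+b.2+1)).2
    rw [h3] at this; omega
  simp [jdt, h, h2]

lemma jdt_off {l : ℕ∞} {T : ℕ × ℕ → ℕ} (b : ℕ × ℕ)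
    (h : ¬ slide (Box l) T (b.1+b.2) = b) :
    jdt (Box l) T b = T b - 1 := by
  simp [jdt, h]

lemma syt_le {l : ℕ∞} {T : ℕ × ℕ → ℕ} (hT : IsSYT l T) (b : ℕ × ℕ) (hb : Box l b)
    (h : b ≠ (0,0)) : 2 ≤ T b := by
  obtain ⟨i, j⟩ := b
  cases j with
  | succ j =>
    have := hT.row_lt (i,j) hb
    have := hT.pos (i,j) hb
    simp only at *; omega
  | zero =>
    cases i with
    | zero => exact absurd rfl h
    | succ i =>
      have h3 := hT.col_lt (i,0) hb
      have h4 : Box l (i,0) := lt_of_le_of_lt (by simp) hb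
      have := hT.pos (i,0) h4
      simp only at *; omega

lemma syt_box0 {l : ℕ∞} {T : ℕ × ℕ → ℕ} (hT : IsSYT l T) : Box l (0,0) := by
  obtain ⟨b, hb, _⟩ := hT.surj 1 one_pos
  exact lt_of_le_of_lt (by simp) hb

lemma syt_one {l : ℕ∞} {T : ℕ × ℕ → ℕ} (hT : IsSYT l T) : T (0,0) = 1 := by
  obtain ⟨b, hb, h⟩ := hT.surj 1 one_pos
  by_cases h1 : b = (0,0)
  · rw [← h1, h]
  · have := syt_le hT b hb h1
    omega

lemma track {l : ℕ∞} {T : ℕ × ℕ → ℕ} (hT : IsSYT l T) (b : ℕ × ℕ) (hb : Box l b)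
    (h : 2 ≤ T b) : ∃ c, Box l c ∧ c ≤ b ∧ jdt (Box l) T c = T b - 1 := by
  have h0 := syt_box0 hT
  by_cases hp : slide (Box l) T (b.1+b.2) = b
  · obtain ⟨m, hm⟩ | hm : (∃ m, b.1+b.2 = m+1) ∨ b.1+b.2 = 0 := by
      rcases hh : b.1+b.2 with _ | m
      · right; rfl
      · left; exact ⟨m, rfl⟩
    · obtain ⟨hc, hs⟩ := slide_box l h0 T m
      refine ⟨slide (Box l) T m, hc, ?_, ?_⟩
      · rw [hm] at hp
        rcases step_cases l T m hc with ⟨e, _⟩ | ⟨e, _⟩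
        · rw [← hp, e]; exact ⟨by simp, by simp⟩
        · rw [← hp, e]; exact ⟨by simp, by simp⟩
      · rw [jdt_on h0 _ (by rw [hs]), hs, ← hm, hp]
    · have : b = (0,0) := by
        ext <;> simp only <;> omega
      have := syt_one hT
      simp_all
  · exact ⟨b, hb, le_rfl, jdt_off b hp⟩

/-- the source box of `c` -/
noncomputable def src (l : ℕ∞) (T : ℕ × ℕ → ℕ) (c : ℕ × ℕ) : ℕ × ℕ :=
  if slide (Box l) T (c.1+c.2) = c then slide (Box l) T (c.1+c.2+1) else c

lemma src_spec {l : ℕ∞} {T : ℕ × ℕ → ℕ} (hT : IsSYT l T) (c : ℕ × ℕ) (hc : Box l c) :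
    jdt (Box l) T c = T (src l T c) - 1 ∧ Box l (src l T c) ∧ 2 ≤ T (src l T c) ∧
     T c ≤ T (src l T c) := by
  have h0 := syt_box0 hT
  by_cases hp : slide (Box l) T (c.1+c.2) = c
  · have h1 := slide_lt hT h0 (c.1+c.2)
    have h2 := hT.pos c hc
    rw [hp] at h1
    simp only [src, if_pos hp]
    exact ⟨jdt_on h0 c hp, (slide_box l h0 T _).1, by omega, by omega⟩
  · simp only [src, if_neg hp]
    refine ⟨jdt_off c hp, hc, syt_le hT c hc ?_, le_rfl⟩
    rintro rfl
    exact hp rfl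

lemma src_inj {l : ℕ∞} {T : ℕ × ℕ → ℕ} (h0 : Box l (0,0)) (b c : ℕ × ℕ)
    (h : src l T b = src l T c) : b = c := by
  have hb := (slide_box l h0 T (b.1+b.2+1)).2
  have hc := (slide_box l h0 T (c.1+c.2+1)).2
  unfold src at h
  split_ifs at h with h1 h2 h2
  · rw [h] at hb
    have : b.1+b.2 = c.1+c.2 := by omega
    rw [← h1, ← h2, this]
  · rw [h] at hb
    rw [← hb] at h
    exact absurd h h2
  · rw [← h] at hc
    rw [← hc] at h
    exact absurd h.symm h1
  · exact h

lemma jdt_syt {l : ℕ∞} {T : ℕ × ℕ → ℕ} (hT : IsSYT l T) : IsSYT l (jdt (Box l) T) := by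
  have h0 := syt_box0 hT
  refine ⟨?_, ?_, ?_, ?_, ?_, ?_⟩
  · intro b hb
    rw [jdt_off, hT.zero_outside b hb]
    intro h
    apply hb
    rw [← h]
    exact (slide_box l h0 T _).1
  · intro b hb
    have := src_spec hT b hb
    omega
  · intro b c hb hc h
    have h1 := src_spec hT b hb
    have h2 := src_spec hT c hc
    exact src_inj h0 b c (hT.inj _ _ h1.2.1 h2.2.1 (by omega))
  · intro n hn
    obtain ⟨b, hb, h⟩ := hT.surj (n+1) (by omega)
    obtain ⟨c, hc, _, h2⟩ := track hT b hb (by omega)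
    exact ⟨c, hc, by omega⟩
  · intro b hb
    have hc : Box l (b.1, b.2+1) := hb
    have h1 := src_spec hT b hb
    have h2 := src_spec hT _ hc
    have h3 := hT.row_lt b hb
    have key : T (src l T b) < T (src l T (b.1, b.2+1)) := by
      by_cases hp : slide (Box l) T (b.1+b.2) = b
      · rcases step_cases l T (b.1+b.2) (by rw [hp]; exact hb) with ⟨e, e1, e2⟩ | ⟨e, e2⟩
        · rw [hp] at e e1 e2
          have : src l T b = (b.1+1, b.2) := by rw [src, if_pos hp, e]
          rw [this]; omega
        · rw [hp] at e
          have : src l T b = (b.1, b.2+1) := by rw [src, if_pos hp, e]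
          rw [this]
          have h4 := slide_lt hT h0 (b.1+b.2+1)
          have h5 : b.1+(b.2+1) = b.1+b.2+1 := by omega
          rw [src, if_pos (by simp only [h5]; exact e)]
          simp only [h5]
          rw [e] at h4
          exact h4
      · have : src l T b = b := by rw [src, if_neg hp]
        rw [this]; omega
    omega
  · intro b hc
    have hb : Box l b := lt_of_le_of_lt (by simp) hc
    have h1 := src_spec hT b hb
    have h2 := src_spec hT _ hc
    have h3 := hT.col_lt b hc
    have key : T (src l T b) < T (src l T (b.1+1, b.2)) := by
      by_cases hp : slide (Box l) T (b.1+b.2) = b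
      · rcases step_cases l T (b.1+b.2) (by rw [hp]; exact hb) with ⟨e, e1, e2⟩ | ⟨e, e2⟩
        · rw [hp] at e
          have : src l T b = (b.1+1, b.2) := by rw [src, if_pos hp, e]
          rw [this]
          have h4 := slide_lt hT h0 (b.1+b.2+1)
          have h5 : b.1+1+b.2 = b.1+b.2+1 := by omega
          rw [src, if_pos (by simp only [h5]; exact e)]
          simp only [h5]
          rw [e] at h4
          exact h4
        · rw [hp] at e e2
          have : src l T b = (b.1, b.2+1) := by rw [src, if_pos hp, e]
          rw [this]
          have h4 := e2 hc
          have h5 : T (b.1, b.2+1) ≠ T (b.1+1, b.2) := by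
            intro h
            have := hT.inj (b.1, b.2+1) (b.1+1, b.2) hb hc h
            simp at this
          omega
      · have : src l T b = b := by rw [src, if_neg hp]
        rw [this]; omega
    omega

lemma track_iter {l : ℕ∞} (m : ℕ) : ∀ {T : ℕ × ℕ → ℕ}, IsSYT l T → ∀ b, Box l b →
    m < T b → ∃ c, Box l c ∧ c ≤ b ∧ (jdt (Box l))^[m] T c = T b - m := by
  induction m with
  | zero => intro T hT b hb h; exact ⟨b, hb, le_rfl, rfl⟩
  | succ m ih =>
    intro T hT b hb h
    obtain ⟨c, hc, hcb, e⟩ := track hT b hb (by omega)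
    obtain ⟨d, hd, hdc, e2⟩ := ih (jdt_syt hT) c hc (by omega)
    refine ⟨d, hd, hdc.trans hcb, ?_⟩
    rw [Function.iterate_succ_apply, e2]; omega

lemma bound_main {l : ℕ∞} {T : ℕ × ℕ → ℕ} (hT : IsSYT l T) (k : ℕ) (hk : 1 ≤ k)
    (hper : (jdt (Box l))^[k] T = T) (n : ℕ) :
    ∀ b : ℕ × ℕ, Box l b → b.1 + b.2 = n → T b ≤ k * n + 1 := by
  induction n using Nat.strong_induction_on with
  | _ n ih =>
    intro b hb hn
    by_cases hz : n = 0
    · have : b = (0,0) := by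
        ext <;> simp only <;> omega
      rw [this, syt_one hT]; omega
    have hkn : k * (n - 1) + k = k * n := by
      obtain ⟨n', rfl⟩ : ∃ n', n = n'+1 := ⟨n-1, by omega⟩
      simp; ring
    by_cases hs : T b ≤ k
    · omega
    obtain ⟨c, hc, hcb, e⟩ := track_iter k hT b hb (by omega)
    rw [hper] at e
    have hne : c ≠ b := by rintro rfl; omega
    have hlt : c.1 + c.2 < n := by
      have h1 := hcb.1
      have h2 := hcb.2
      by_contra hh
      apply hne
      ext <;> omega
    have h3 := ih _ hlt c hc rfl
    have h4 : k * (c.1 + c.2) ≤ k * (n-1) := Nat.mul_le_mul_left _ (by omega)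
    omega

/-- Let `μ` be `(∞^l)` for some `l ≥ 1` or `(∞^∞)`.  If `T ∈ SYT(μ)` is
`k`-periodic, then `T_{i,j} ≤ k (i + j - 2) + 1` for every box (in 0-based
coordinates, `T b ≤ k (b.1 + b.2) + 1`); moreover if `μ = (∞^l)` then `k ≥ l`. -/
theorem stmt_8 (l : ℕ∞) (hl : l = ⊤ ∨ ∃ l₀ : ℕ, 1 ≤ l₀ ∧ l = (l₀ : ℕ∞))
    (T : ℕ × ℕ → ℕ) (hT : IsSYT l T) (k : ℕ) (hk : 1 ≤ k)
    (hper : (jdt (Box l))^[k] T = T) :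
    (∀ b : ℕ × ℕ, Box l b → T b ≤ k * (b.1 + b.2) + 1) ∧
    (∀ l₀ : ℕ, l = (l₀ : ℕ∞) → l₀ ≤ k) := by
  have hB := fun b hb => bound_main hT k hk hper _ b hb rfl
  refine ⟨hB, ?_⟩
  rintro l₀ rfl
  by_contra hlt
  push Not at hlt
  have hcard : (Finset.range l₀ ×ˢ Finset.range (k * l₀ + 2)).card
      ≤ (Finset.Icc 1 (k * (l₀ + (k * l₀ + 2)) + 1)).card := by
    apply Finset.card_le_card_of_injOn T
    · rintro ⟨i, j⟩ h
      simp only [Finset.coe_product, Finset.coe_range, Set.mem_prod, Set.mem_Iio] at h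
      have hb : Box (l₀ : ℕ∞) (i, j) := by
        unfold Box; exact_mod_cast h.1
      have h1 := hB _ hb
      have h2 := hT.pos _ hb
      have h3 : k * (i + j) ≤ k * (l₀ + (k * l₀ + 2)) := Nat.mul_le_mul_left _ (by omega)
      simp only [Finset.coe_Icc, Set.mem_Icc]
      simp only at h1
      omega
    · rintro ⟨i, j⟩ h ⟨i', j'⟩ h' he
      simp only [Finset.coe_product, Finset.coe_range, Set.mem_prod, Set.mem_Iio] at h h'
      refine hT.inj _ _ ?_ ?_ he
      · unfold Box; exact_mod_cast h.1
      · unfold Box; exact_mod_cast h'.1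
  simp only [Finset.card_product, Finset.card_range, Nat.card_Icc] at hcard
  have h5 : (k + 1) * (k * l₀ + 2) ≤ l₀ * (k * l₀ + 2) := Nat.mul_le_mul_right _ hlt
  have h6 : l₀ * (k * l₀ + 2) ≤ k * (l₀ + (k * l₀ + 2)) + 1 := by omega
  nlinarith
end

section
/- Let l ∈ ℕ, let σ be a weakly decreasing skew shape contained in (∞^l) with ℓ(σ) = l, let S be a standard skew Young tableau of shape σ with k = |σ| entries, let λ be a partition of n with at most l rows, and let B be a standard Young tableau of shape λ such that B ◁ S is a standard filling. Then the iterated left smash T = B ◁ S ◁ S ◁ ⋯ is an infinite standard Young tableau of shape (∞^l), and jdt^n(T) is k-periodic, i.e., jdt^{n+k}(T) = jdt^n(T). -/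
open scoped Classical

/-- A 0-based box of the Young diagram of the partition with row lengths `lam`. -/
def YBox (lam : ℕ → ℕ) (b : ℕ × ℕ) : Prop := b.2 < lam b.1

/-- `lam : ℕ → ℕ` (0-based row lengths) is a partition of `n`. -/
structure IsPartition (lam : ℕ → ℕ) (n : ℕ) : Prop where
  antitone : ∀ i : ℕ, lam (i + 1) ≤ lam i
  finite : {b : ℕ × ℕ | YBox lam b}.Finite
  card : {b : ℕ × ℕ | YBox lam b}.ncard = n

/-- `S` is a (finite) standard Young tableau of shape `lam` with `n` boxes:
a filling of the diagram of `lam` by `1, …, n` (with junk value `0` off the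
diagram), strictly increasing along rows and columns. -/
structure IsFinSYT (lam : ℕ → ℕ) (n : ℕ) (S : ℕ × ℕ → ℕ) : Prop where
  zero_outside : ∀ b : ℕ × ℕ, ¬ YBox lam b → S b = 0
  lb : ∀ b : ℕ × ℕ, YBox lam b → 1 ≤ S b
  ub : ∀ b : ℕ × ℕ, YBox lam b → S b ≤ n
  inj : ∀ b c : ℕ × ℕ, YBox lam b → YBox lam c → S b = S c → b = c
  surj : ∀ m : ℕ, 1 ≤ m → m ≤ n → ∃ b : ℕ × ℕ, YBox lam b ∧ S b = m
  row_lt : ∀ b : ℕ × ℕ, YBox lam (b.1, b.2 + 1) → S b < S (b.1, b.2 + 1)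
  col_lt : ∀ b : ℕ × ℕ, YBox lam (b.1 + 1, b.2) → S b < S (b.1 + 1, b.2)

/-- A 0-based box of the skew diagram `λ̂ / ν` (row lengths `lamh` resp. `nu`). -/
def SkewBox (nu lamh : ℕ → ℕ) (b : ℕ × ℕ) : Prop := nu b.1 ≤ b.2 ∧ b.2 < lamh b.1

/-- `λ̂ / ν` is a skew shape with `k` boxes. -/
structure IsSkewShape (nu lamh : ℕ → ℕ) (k : ℕ) : Prop where
  nu_antitone : ∀ i : ℕ, nu (i + 1) ≤ nu i
  lamh_antitone : ∀ i : ℕ, lamh (i + 1) ≤ lamh i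
  le : ∀ i : ℕ, nu i ≤ lamh i
  finite : {b : ℕ × ℕ | SkewBox nu lamh b}.Finite
  card : {b : ℕ × ℕ | SkewBox nu lamh b}.ncard = k

/-- The skew shape `λ̂ / ν` is weakly decreasing: `σ_i ≥ σ_{i+1}` for all rows. -/
def WeaklyDecreasing (nu lamh : ℕ → ℕ) : Prop :=
  ∀ i : ℕ, lamh (i + 1) - nu (i + 1) ≤ lamh i - nu i

/-- `ℓ(λ̂ / ν) = l`: the last (1-based) row containing a box of the skew shape is
row `l`, i.e. the 0-based row `l - 1`. -/
def SkewHeight (nu lamh : ℕ → ℕ) (l : ℕ) : Prop :=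
  nu (l - 1) < lamh (l - 1) ∧ ∀ i : ℕ, l ≤ i → lamh i = nu i

/-- `S` is a standard skew Young tableau of shape `λ̂ / ν` with entries `1, …, k`. -/
structure IsSkewSYT (nu lamh : ℕ → ℕ) (k : ℕ) (S : ℕ × ℕ → ℕ) : Prop where
  zero_outside : ∀ b : ℕ × ℕ, ¬ SkewBox nu lamh b → S b = 0
  lb : ∀ b : ℕ × ℕ, SkewBox nu lamh b → 1 ≤ S b
  ub : ∀ b : ℕ × ℕ, SkewBox nu lamh b → S b ≤ k
  inj : ∀ b c : ℕ × ℕ, SkewBox nu lamh b → SkewBox nu lamh c → S b = S c → b = c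
  surj : ∀ m : ℕ, 1 ≤ m → m ≤ k → ∃ b : ℕ × ℕ, SkewBox nu lamh b ∧ S b = m
  row_lt : ∀ b : ℕ × ℕ, SkewBox nu lamh b → SkewBox nu lamh (b.1, b.2 + 1) →
    S b < S (b.1, b.2 + 1)
  col_lt : ∀ b : ℕ × ℕ, SkewBox nu lamh b → SkewBox nu lamh (b.1 + 1, b.2) →
    S b < S (b.1 + 1, b.2)

/-- Iterated left smash `B ◁ S ◁ S ◁ ⋯` of a finite standard Young tableau `B` of
shape `lam` (a partition of `n`) with infinitely many copies of a standard skew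
Young tableau `S` of shape `λ̂ / ν` with `k` boxes: row `i` of the result starts
with row `i` of `B` and then consists of the successive copies of row `i` of `S`
(of length `lamh i - nu i`), the `c`-th copy being incremented by `n + c * k`. -/
noncomputable def smashInf (l : ℕ∞) (n k : ℕ) (lam : ℕ → ℕ) (B : ℕ × ℕ → ℕ)
    (nu lamh : ℕ → ℕ) (S : ℕ × ℕ → ℕ) : ℕ × ℕ → ℕ := fun b =>
  if Box l b then
    if b.2 < lam b.1 then B b
    else S (b.1, nu b.1 + (b.2 - lam b.1) % (lamh b.1 - nu b.1)) + n
          + ((b.2 - lam b.1) / (lamh b.1 - nu b.1)) * k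
  else 0

/-- `B ◁ S` is a standard filling: the finite filling obtained by placing the first
copy of `S` (incremented by `n`) to the right of `B` has strictly increasing rows
and columns. -/
def BSstandard (l n : ℕ) (lam nu lamh : ℕ → ℕ) (B S : ℕ × ℕ → ℕ) : Prop :=
  let F : ℕ × ℕ → ℕ := fun b =>
    if b.2 < lam b.1 then B b else S (b.1, nu b.1 + (b.2 - lam b.1)) + n
  let m : ℕ → ℕ := fun i => if i < l then lam i + (lamh i - nu i) else 0
  (∀ i j : ℕ, j + 1 < m i → F (i, j) < F (i, j + 1)) ∧
  (∀ i j : ℕ, j < m i → j < m (i + 1) → F (i, j) < F (i + 1, j))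

namespace Pit

/-- running maximum -/
def pm (f : ℕ → ℤ) : ℕ → ℤ
  | 0 => f 0
  | m + 1 => max (pm f m) (f (m + 1))

theorem pm_ge (f : ℕ → ℤ) {s m : ℕ} (h : s ≤ m) : f s ≤ pm f m := by
  induction m with
  | zero => obtain rfl : s = 0 := by omega
            simp [pm]
  | succ m ih =>
    rcases Nat.lt_or_ge m s with h1 | h1
    · obtain rfl : s = m + 1 := by omega
      simp [pm]
    · exact le_trans (ih h1) (le_max_left _ _)

theorem pm_ex (f : ℕ → ℤ) (m : ℕ) : ∃ s, s ≤ m ∧ pm f m = f s := by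
  induction m with
  | zero => exact ⟨0, le_refl _, rfl⟩
  | succ m ih =>
    obtain ⟨s, hs, h⟩ := ih
    rcases le_total (pm f m) (f (m+1)) with h1 | h1
    · exact ⟨m+1, le_refl _, by simp [pm, h1]⟩
    · exact ⟨s, by omega, by simp [pm, h1, ← h]⟩

theorem pm_mono (f : ℕ → ℤ) {s m : ℕ} (h : s ≤ m) : pm f s ≤ pm f m := by
  obtain ⟨t, ht, e⟩ := pm_ex f s
  rw [e]; exact pm_ge f (by omega)

theorem pm_le_iff (f : ℕ → ℤ) (m : ℕ) (c : ℤ) : pm f m ≤ c ↔ ∀ s, s ≤ m → f s ≤ c := by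
  constructor
  · intro h s hs; exact le_trans (pm_ge f hs) h
  · intro h
    obtain ⟨t, ht, e⟩ := pm_ex f m
    rw [e]; exact h t ht

theorem pm_touch (f : ℕ → ℤ) (hf : ∀ m, f (m+1) ≤ f m + 1) {s m : ℕ} (h : s ≤ m)
    (hlt : pm f s < pm f m) : ∃ t, s ≤ t ∧ t ≤ m ∧ f t = pm f s ∧ pm f t = pm f s := by
  induction m with
  | zero => obtain rfl : s = 0 := by omega
            omega
  | succ m ih =>
    rcases Nat.lt_or_ge m s with h1 | h1
    · obtain rfl : s = m + 1 := by omega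
      omega
    · rcases (pm_mono f h1).lt_or_eq with h2 | h2
      · obtain ⟨t, a, b, c⟩ := ih h1 h2
        exact ⟨t, a, by omega, c⟩
      · refine ⟨m, h1, by omega, ?_, h2.symm⟩
        have h3 := hf m
        have h4 := pm_ge f (le_refl m)
        simp only [pm] at hlt
        rcases lt_max_iff.1 hlt with h5 | h5 <;> omega

theorem core (f : ℕ → ℤ) (hf : ∀ m, f (m+1) ≤ f m + 1) {s m : ℕ} (h : s ≤ m) (c : ℤ) :
    (∀ t, s ≤ t → t ≤ m → f t - 2 * pm f t ≤ c - pm f m - pm f s) ↔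
    (∀ t, s ≤ t → t ≤ m → f t ≤ c) := by
  constructor
  · intro H t h1 h2
    rcases (pm_mono f h).lt_or_eq with h3 | h3
    · obtain ⟨u, a, b, e1, e2⟩ := pm_touch f hf h h3
      have := H u a b
      have := pm_ge f h2
      omega
    · have := H t h1 h2
      have := pm_mono f h1
      have := pm_mono f h2
      omega
  · intro H t h1 h2
    have a1 := pm_mono f h1
    have a2 := pm_mono f h2
    have a3 := pm_ge f (le_refl t)
    obtain ⟨u, hu, e⟩ := pm_ex f m
    have a4 := H t h1 h2
    rcases Nat.lt_or_ge u s with h4 | h4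
    · have := pm_ge f h4.le
      omega
    · have := H u h4 hu
      omega

abbrev Pth := ℕ → ℕ → ℤ

structure Valid (x : Pth) : Prop where
  zero : ∀ i, x i 0 = 0
  step : ∀ m, ∃ a, ∀ i, x i (m+1) = x i m + if i = a then 1 else 0

def ff (i : ℕ) (x : Pth) : ℕ → ℤ := fun t => x (i+1) t - x i t

def E (i : ℕ) (x : Pth) : Pth := fun r m =>
  if r = i then x i m + pm (ff i x) m
  else if r = i + 1 then x (i+1) m - pm (ff i x) m
  else x r m

def sh (x : Pth) : Pth := fun i m => x i (m+1) - x i 1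

theorem E_top (i : ℕ) (x : Pth) (m : ℕ) : E i x i m = x i m + pm (ff i x) m := by simp [E]
theorem E_bot (i : ℕ) (x : Pth) (m : ℕ) : E i x (i+1) m = x (i+1) m - pm (ff i x) m := by simp [E]
theorem E_oth (i : ℕ) (x : Pth) (r m : ℕ) (h : r ≠ i) (h' : r ≠ i + 1) : E i x r m = x r m := by
  simp [E, h, h']

theorem Valid.ff_step {x : Pth} (h : Valid x) (i m : ℕ) : ff i x (m+1) ≤ ff i x m + 1 := by
  obtain ⟨a, ha⟩ := h.step m
  have h1 := ha i
  have h2 := ha (i+1)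
  simp only [ff]
  split_ifs at h1 h2 <;> omega

theorem Valid.sh {x : Pth} (h : Valid x) : Valid (sh x) := by
  refine ⟨fun i => by simp [Pit.sh], fun m => ?_⟩
  obtain ⟨a, ha⟩ := h.step (m+1)
  refine ⟨a, fun i => ?_⟩
  have := ha i
  simp only [Pit.sh]
  omega

theorem Valid.E {x : Pth} (h : Valid x) (i : ℕ) : Valid (E i x) := by
  constructor
  · intro r
    have h1 := h.zero i
    have h2 := h.zero (i+1)
    have h3 := h.zero r
    simp only [Pit.E, pm, ff]
    split_ifs <;> omega
  · intro m
    obtain ⟨a, ha⟩ := h.step m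
    have h1 := ha i
    have h2 := ha (i+1)
    have h4 := pm_ge (ff i x) (le_refl m)
    have h5 : pm (ff i x) (m+1) = max (pm (ff i x) m) (ff i x (m+1)) := rfl
    have h6 := h.ff_step i m
    rcases le_or_gt (ff i x (m+1)) (pm (ff i x) m) with h7 | h7
    · rw [max_eq_left h7] at h5
      refine ⟨a, fun r => ?_⟩
      have h3 := ha r
      simp only [Pit.E, h5]
      split_ifs at * <;> omega
    · rw [max_eq_right h7.le] at h5
      refine ⟨i, fun r => ?_⟩
      have h3 := ha r
      simp only [Pit.E, h5]
      simp only [ff] at *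
      split_ifs at * <;> omega

theorem E_fix {x : Pth} (h : Valid x) (i : ℕ) (hl : ∀ m, x (i+1) m ≤ x i m) : E i x = x := by
  have : ∀ m, pm (ff i x) m = 0 := by
    intro m
    apply le_antisymm
    · rw [pm_le_iff]; intro s _; have := hl s; simp only [ff]; omega
    · have := pm_ge (ff i x) (Nat.zero_le m)
      simpa [ff, h.zero] using this
  funext r m
  simp only [E, this]
  split_ifs with h1 h2
  · subst h1; simp
  · subst h2; simp
  · rfl

theorem E_idem {x : Pth} (h : Valid x) (i : ℕ) : E i (E i x) = E i x := by
  apply E_fix (h.E i)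
  intro m
  rw [E_top, E_bot]
  have h1 := pm_ge (ff i x) (le_refl m)
  have h2 := pm_ge (ff i x) (Nat.zero_le m)
  have h3 := h.zero i
  have h4 := h.zero (i+1)
  simp only [ff] at *
  omega

theorem E_comm (x : Pth) (i j : ℕ) (hij : i + 1 < j) : E i (E j x) = E j (E i x) := by
  have h1 : ff i (E j x) = ff i x := by
    funext t
    simp only [ff]
    rw [E_oth j x _ _ (by omega) (by omega), E_oth j x _ _ (by omega) (by omega)]
  have h2 : ff j (E i x) = ff j x := by
    funext t
    simp only [ff]
    rw [E_oth i x _ _ (by omega) (by omega), E_oth i x _ _ (by omega) (by omega)]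
  funext r m
  have a : ∀ r, E i (E j x) r m = if r = i then E j x i m + pm (ff i x) m
      else if r = i + 1 then E j x (i+1) m - pm (ff i x) m else E j x r m := by
    intro r; rw [← h1]; rfl
  have b : ∀ r, E j (E i x) r m = if r = j then E i x j m + pm (ff j x) m
      else if r = j + 1 then E i x (j+1) m - pm (ff j x) m else E i x r m := by
    intro r; rw [← h2]; rfl
  rw [a, b]
  simp only [E]
  split_ifs <;> omega

/-- isometry, max version -/
theorem iso_max {x : Pth} (h : Valid x) (i : ℕ) {s m : ℕ} (hsm : s ≤ m) (c : ℤ) :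
    (∀ t, s ≤ t → t ≤ m → E i x (i+1) t - E i x (i+1) s + E i x i m - E i x i t ≤ c) ↔
    (∀ t, s ≤ t → t ≤ m → x (i+1) t - x (i+1) s + x i m - x i t ≤ c) := by
  have := core (ff i x) (h.ff_step i) hsm (c + x (i+1) s - x i m)
  simp only [E_top, E_bot]
  refine Iff.trans ?_ (this.trans ?_)
  · refine forall_congr' fun t => forall_congr' fun _ => forall_congr' fun _ => ?_
    simp only [ff]
    constructor <;> intro _ <;> omega
  · refine forall_congr' fun t => forall_congr' fun _ => forall_congr' fun _ => ?_
    simp only [ff]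
    constructor <;> intro _ <;> omega

theorem iso_min {x : Pth} (h : Valid x) (i : ℕ) {s m : ℕ} (hsm : s ≤ m) (c : ℤ) :
    (∀ t, s ≤ t → t ≤ m → c ≤ E i x i t - E i x i s + E i x (i+1) m - E i x (i+1) t) ↔
    (∀ t, s ≤ t → t ≤ m → c ≤ x i t - x i s + x (i+1) m - x (i+1) t) := by
  have := core (ff i x) (h.ff_step i) hsm (- c - x i s + x (i+1) m)
  simp only [E_top, E_bot]
  refine Iff.trans ?_ (this.trans ?_)
  · refine forall_congr' fun t => forall_congr' fun _ => forall_congr' fun _ => ?_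
    simp only [ff]
    constructor <;> intro _ <;> omega
  · refine forall_congr' fun t => forall_congr' fun _ => forall_congr' fun _ => ?_
    simp only [ff]
    constructor <;> intro _ <;> omega

theorem top_le_iff (x : Pth) (i m : ℕ) (c : ℤ) :
    E i x i m ≤ c ↔ ∀ t, t ≤ m → x (i+1) t + x i m - x i t ≤ c := by
  rw [E_top]
  have := pm_le_iff (ff i x) m (c - x i m)
  constructor
  · intro h t ht
    have := (this.1 (by omega)) t ht
    simp only [ff] at this
    omega
  · intro h
    have := this.2 (fun t ht => by have := h t ht; simp only [ff]; omega)
    omega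

theorem le_bot_iff (x : Pth) (i m : ℕ) (c : ℤ) :
    c ≤ E i x (i+1) m ↔ ∀ t, t ≤ m → c ≤ x i t + x (i+1) m - x (i+1) t := by
  rw [E_bot]
  have := pm_le_iff (ff i x) m (x (i+1) m - c)
  constructor
  · intro h t ht
    have := (this.1 (by omega)) t ht
    simp only [ff] at this
    omega
  · intro h
    have := this.2 (fun t ht => by have := h t ht; simp only [ff]; omega)
    omega

theorem top2_le_iff (x : Pth) (i m : ℕ) (c : ℤ) :
    E i (E (i+1) x) i m ≤ c ↔ ∀ s, s ≤ m → ∀ t, s ≤ t → t ≤ m →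
      x (i+1) t - x (i+1) s + x i m - x i t ≤ c - x (i+2) s := by
  rw [top_le_iff]
  have e : ∀ t, E (i+1) x i t = x i t := fun t => E_oth _ _ _ _ (by omega) (by omega)
  simp only [e]
  constructor
  · intro H s hs t h1 h2
    have := (top_le_iff x (i+1) t (c - x i m + x i t)).1 (by have := H t h2; omega) s h1
    have e2 : x (i+1+1) s = x (i+2) s := rfl
    omega
  · intro H t ht
    have := (top_le_iff x (i+1) t (c - x i m + x i t)).2 (by
      intro s hs
      have := H s (by omega) t hs ht
      have e2 : x (i+1+1) s = x (i+2) s := rfl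
      omega)
    omega

theorem le_bot2_iff (x : Pth) (i m : ℕ) (c : ℤ) :
    c ≤ E (i+1) (E i x) (i+2) m ↔ ∀ s, s ≤ m → ∀ t, s ≤ t → t ≤ m →
      c - x i s ≤ x (i+1) t - x (i+1) s + x (i+2) m - x (i+2) t := by
  have := le_bot_iff (E i x) (i+1) m c
  rw [show i + 2 = i + 1 + 1 from rfl, this]
  have e : ∀ t, E i x (i+1+1) t = x (i+2) t := fun t => E_oth _ _ _ _ (by omega) (by omega)
  simp only [e]
  constructor
  · intro H s hs t h1 h2
    have := (le_bot_iff x i t (c - x (i+2) m + x (i+2) t)).1 (by have := H t h2; omega) s h1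
    have e2 : ∀ s, x (i+1+1) s = x (i+2) s := fun _ => rfl
    simp only [e2]
    omega
  · intro H t ht
    have := (le_bot_iff x i t (c - x (i+2) m + x (i+2) t)).2 (by
      intro s hs
      have := H s (by omega) t hs ht
      have e2 : ∀ s, x (i+1+1) s = x (i+2) s := fun _ => rfl
      simp only [e2] at this
      omega)
    omega

theorem E_sum (x : Pth) (i m : ℕ) : E i x i m + E i x (i+1) m = x i m + x (i+1) m := by
  rw [E_top, E_bot]; ring

theorem braid {x : Pth} (h : Valid x) (i : ℕ) :
    E i (E (i+1) (E i x)) = E (i+1) (E i (E (i+1) x)) := by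
  have sum3 : ∀ (y : Pth) m, E i y i m + E i y (i+1) m + E i y (i+2) m
      = y i m + y (i+1) m + y (i+2) m := by
    intro y m
    have := E_sum y i m
    have := E_oth i y (i+2) m (by omega) (by omega)
    omega
  have sum3' : ∀ (y : Pth) m, E (i+1) y i m + E (i+1) y (i+1) m + E (i+1) y (i+2) m
      = y i m + y (i+1) m + y (i+2) m := by
    intro y m
    have := E_sum y (i+1) m
    have e2 : ∀ y : Pth, y (i+1+1) m = y (i+2) m := fun _ => rfl
    have e3 := e2 y
    have e4 := e2 (E (i+1) y)
    rw [e3, e4] at this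
    have := E_oth (i+1) y i m (by omega) (by omega)
    omega
  have top : ∀ m, E i (E (i+1) (E i x)) i m = E (i+1) (E i (E (i+1) x)) i m := by
    intro m
    rw [E_oth (i+1) (E i (E (i+1) x)) i m (by omega) (by omega)]
    refine eq_of_forall_ge_iff fun c => ?_
    rw [top2_le_iff, top2_le_iff]
    refine forall_congr' fun s => forall_congr' fun hs => ?_
    rw [iso_max h i hs, E_oth i x (i+2) s (by omega) (by omega)]
  have bot : ∀ m, E i (E (i+1) (E i x)) (i+2) m = E (i+1) (E i (E (i+1) x)) (i+2) m := by
    intro m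
    rw [E_oth i (E (i+1) (E i x)) (i+2) m (by omega) (by omega)]
    refine eq_of_forall_le_iff fun c => ?_
    rw [le_bot2_iff, le_bot2_iff]
    refine forall_congr' fun s => forall_congr' fun hs => ?_
    have := iso_min h (i+1) hs (c - x i s)
    rw [E_oth (i+1) x i s (by omega) (by omega)]
    exact this.symm
  funext r m
  by_cases h0 : r = i
  · rw [h0]; exact top m
  by_cases h2 : r = i + 2
  · rw [h2]; exact bot m
  by_cases h1 : r = i + 1
  · rw [h1]
    have a1 := sum3 (E (i+1) (E i x)) m
    have a2 := sum3' (E i x) m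
    have a3 := sum3 x m
    have b1 := sum3' (E i (E (i+1) x)) m
    have b2 := sum3 (E (i+1) x) m
    have b3 := sum3' x m
    have := top m
    have := bot m
    omega
  · iterate 6 rw [E_oth _ _ _ _ (by omega) (by omega)]

theorem E_sh_E {x : Pth} (h : Valid x) (i : ℕ) : E i (sh (E i x)) = E i (sh x) := by
  have top : ∀ m, E i (sh (E i x)) i m = E i (sh x) i m := by
    intro m
    refine eq_of_forall_ge_iff fun c => ?_
    rw [top_le_iff, top_le_iff]
    have key : ∀ y : Pth, (∀ t, t ≤ m → sh y (i+1) t + sh y i m - sh y i t ≤ c) ↔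
        ∀ t, 1 ≤ t → t ≤ m + 1 → y (i+1) t - y (i+1) 1 + y i (m+1) - y i t ≤ c := by
      intro y
      constructor
      · intro H t h1 h2
        have := H (t-1) (by omega)
        simp only [sh, Nat.sub_add_cancel h1] at this
        omega
      · intro H t h1
        have := H (t+1) (by omega) (by omega)
        simp only [sh]
        omega
    rw [key, key, iso_max h i (by omega)]
  funext r m
  by_cases h0 : r = i
  · rw [h0]; exact top m
  by_cases h1 : r = i + 1
  · rw [h1]
    have := E_sum (sh (E i x)) i m
    have := E_sum (sh x) i m
    have := E_sum x i (m+1)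
    have := E_sum x i 1
    have := top m
    simp only [sh] at *
    omega
  · rw [E_oth _ _ _ _ h0 h1, E_oth _ _ _ _ h0 h1]
    simp only [sh]
    rw [E_oth _ _ _ _ h0 h1, E_oth _ _ _ _ h0 h1]

def D : ℕ → Pth → Pth
  | 0, x => x
  | j + 1, x => E j (D j x)

def R : ℕ → Pth → Pth
  | 0, x => x
  | j + 1, x => R j (D j x)

theorem Valid.D {x : Pth} (h : Valid x) (j : ℕ) : Valid (D j x) := by
  induction j with
  | zero => exact h
  | succ j ih => exact ih.E j

theorem Valid.R {x : Pth} (h : Valid x) (j : ℕ) : Valid (R j x) := by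
  induction j generalizing x with
  | zero => exact h
  | succ j ih => exact ih (h.D j)

theorem D_E0 {x : Pth} (h : Valid x) (j : ℕ) : D (j+1) (E 0 x) = D (j+1) x := by
  induction j with
  | zero => exact E_idem h 0
  | succ j ih => show E (j+1) (D (j+1) (E 0 x)) = _; rw [ih]; rfl

theorem E_D_comm {x : Pth} (i j : ℕ) (hij : j < i) : D j (E i x) = E i (D j x) := by
  induction j with
  | zero => rfl
  | succ j ih =>
    show E j (D j (E i x)) = E i (E j (D j x))
    rw [ih (by omega), E_comm _ _ _ hij]

theorem D_E {x : Pth} (h : Valid x) (i j : ℕ) (hij : i + 1 < j) :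
    D j (E (i+1) x) = E i (D j x) := by
  induction j with
  | zero => omega
  | succ j ih =>
    rcases Nat.lt_or_ge (i+1) j with h1 | h1
    · show E j (D j (E (i+1) x)) = E i (E j (D j x))
      rw [ih h1, E_comm _ _ _ h1]
    · obtain rfl : j = i + 1 := by omega
      show E (i+1) (E i (D i (E (i+1) x))) = E i (E (i+1) (E i (D i x)))
      rw [E_D_comm _ _ (by omega), braid (h.D i)]

theorem R_E {x : Pth} (h : Valid x) (N i : ℕ) (hi : i + 1 < N) : R N (E i x) = R N x := by
  induction N generalizing x i with
  | zero => omega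
  | succ N ih =>
    show R N (D N (E i x)) = R N (D N x)
    cases i with
    | zero =>
      obtain ⟨M, rfl⟩ : ∃ M, N = M + 1 := ⟨N - 1, by omega⟩
      rw [D_E0 h]
    | succ i =>
      rw [D_E h i N (by omega), ih (h.D N) i (by omega)]

theorem R_D {x : Pth} (h : Valid x) (N j : ℕ) (hj : j < N) : R N (D j x) = R N x := by
  induction j with
  | zero => rfl
  | succ j ih =>
    show R N (E j (D j x)) = _
    rw [R_E (h.D j) N j hj, ih (by omega)]

theorem R_sh_E {x : Pth} (h : Valid x) (N i : ℕ) (hi : i + 1 < N) :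
    R N (sh (E i x)) = R N (sh x) := by
  rw [← R_E (h.E i).sh N i hi, E_sh_E h, R_E h.sh N i hi]

theorem R_sh_D {x : Pth} (h : Valid x) (N j : ℕ) (hj : j < N) :
    R N (sh (D j x)) = R N (sh x) := by
  induction j with
  | zero => rfl
  | succ j ih =>
    show R N (sh (E j (D j x))) = _
    rw [R_sh_E (h.D j) N j hj, ih (by omega)]

theorem R_sh_R {x : Pth} (h : Valid x) (N j : ℕ) (hj : j ≤ N) :
    R N (sh (R j x)) = R N (sh x) := by
  induction j generalizing x with
  | zero => rfl
  | succ j ih =>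
    show R N (sh (R j (D j x))) = _
    rw [ih (h.D j) (by omega), R_sh_D h N j (by omega)]

def Lat (x : Pth) : Prop := ∀ i m, x (i+1) m ≤ x i m

theorem D_fix {x : Pth} (h : Valid x) (hl : Lat x) (j : ℕ) : D j x = x := by
  induction j with
  | zero => rfl
  | succ j ih => show E j (D j x) = x; rw [ih, E_fix h j (hl j)]

theorem R_fix {x : Pth} (h : Valid x) (hl : Lat x) (j : ℕ) : R j x = x := by
  induction j with
  | zero => rfl
  | succ j ih => show R j (D j x) = x; rw [D_fix h hl, ih]

/-- row of the hole -/
noncomputable def rho (x : Pth) : ℕ → ℕ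
  | 0 => 0
  | m + 1 =>
    if x (rho x m + 1) (m+2) = x (rho x m + 1) (m+1) + 1 ∧
      x (rho x m + 1) (m+2) = x (rho x m) (m+2) then rho x m + 1 else rho x m

theorem rho_inv {x : Pth} (h : Valid x) (hl : Lat x) (m : ℕ) :
    x (rho x m + 1) (m+1) < x (rho x m) (m+1) := by
  induction m with
  | zero =>
    obtain ⟨a, ha⟩ := h.step 0
    have a0 : a = 0 := by
      by_contra hne
      obtain ⟨b, rfl⟩ : ∃ b, a = b + 1 := ⟨a - 1, by omega⟩
      have h1 := ha (b+1)
      have h2 := ha b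
      have h3 := hl b 1
      simp [h.zero] at h1 h2
      omega
    subst a0
    have h1 := ha 1
    have h2 := ha 0
    simp [h.zero] at h1 h2
    simp [rho, h1, h2]
  | succ m ih =>
    obtain ⟨a, ha⟩ := h.step (m+1)
    simp only [rho]
    split_ifs with hc
    · have h1 := ha (rho x m + 1)
      have h2 := ha (rho x m + 1 + 1)
      have h3 := hl (rho x m + 1) (m+1)
      have e : m + 1 + 1 = m + 2 := rfl
      rw [e] at *
      split_ifs at h1 h2 <;> omega
    · have h1 := ha (rho x m + 1)
      have h2 := ha (rho x m)
      have h3 := hl (rho x m) (m+2)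
      have e : m + 1 + 1 = m + 2 := rfl
      rw [e] at *
      split_ifs at h1 h2 <;> omega

theorem rho_step (x : Pth) (m : ℕ) : rho x m ≤ rho x (m+1) ∧ rho x (m+1) ≤ rho x m + 1 := by
  simp only [rho]
  split_ifs <;> omega

theorem rho_mono (x : Pth) : Monotone (rho x) := monotone_nat_of_le_succ fun m => (rho_step x m).1

noncomputable def zz (j : ℕ) (x : Pth) : Pth := fun i m =>
  x i (m+1) - if i = min (rho x m) j then 1 else 0

noncomputable def zf (x : Pth) : Pth := fun i m =>
  x i (m+1) - if i = rho x m then 1 else 0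

theorem zz_zero {x : Pth} (h : Valid x) (hl : Lat x) : zz 0 x = sh x := by
  have h0 : x 1 1 < x 0 1 := rho_inv h hl 0
  obtain ⟨a, ha⟩ := h.step 0
  have z := h.zero
  have h1 : x 0 1 = x 0 0 + _ := ha 0
  have h2 : x 1 1 = x 1 0 + _ := ha 1
  rw [z] at h1 h2
  have a0 : a = 0 := by
    split_ifs at h1 h2 <;> omega
  subst a0
  funext i m
  have := ha i
  simp only [zz, sh]
  simp [z] at this
  simp [this]

theorem zz_pm {x : Pth} (h : Valid x) (hl : Lat x) (j m : ℕ) :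
    pm (ff j (zz j x)) m = if j < rho x m then 1 else 0 := by
  have hf : ∀ s, ff j (zz j x) s = x (j+1) (s+1) - x j (s+1) + if j ≤ rho x s then 1 else 0 := by
    intro s
    simp only [ff, zz]
    split_ifs <;> omega
  induction m with
  | zero =>
    have h0 : x (j+1) 1 - x j 1 + (if j ≤ rho x 0 then 1 else 0) = 0 := by
      have e := congrFun (congrFun (zz_zero h hl) j) 0
      have e' := congrFun (congrFun (zz_zero h hl) (j+1)) 0
      simp only [zz, sh, rho] at *
      simp only [zero_add] at *
      split_ifs at * <;> omega
    have h1 : pm (ff j (zz j x)) 0 = 0 := (hf 0).trans h0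
    rw [h1, rho]
    simp
  | succ m ih =>
    simp only [pm, ih, hf]
    have h1 := hl j (m+1+1)
    have h2 := rho_step x m
    by_cases c1 : j < rho x m
    · rw [if_pos c1, if_pos (by omega), if_pos (by omega)]
      omega
    · by_cases c2 : j < rho x (m+1)
      · have c3 : rho x m = j := by omega
        have c4 : x (j+1) (m+2) = x j (m+2) := by
          have : rho x (m+1) ≠ rho x m := by omega
          simp only [rho] at this
          split_ifs at this with hh
          · rw [c3] at hh; exact hh.2
          · exact absurd rfl this
        rw [if_neg c1, if_pos c2, if_pos (by omega), show m + 1 + 1 = m + 2 from rfl, c4]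
        simp
      · rw [if_neg c1, if_neg c2]
        have h3 := rho_inv h hl (m+1)
        split_ifs with c5
        · have : rho x (m+1) = j := by omega
          rw [this] at h3
          omega
        · omega

theorem E_zz {x : Pth} (h : Valid x) (hl : Lat x) (j : ℕ) : E j (zz j x) = zz (j+1) x := by
  funext r m
  simp only [E, zz_pm h hl, zz]
  split_ifs <;> first | omega | (subst_vars; omega)

theorem D_zz {x : Pth} (h : Valid x) (hl : Lat x) (j : ℕ) : D j (sh x) = zz j x := by
  induction j with
  | zero => exact (zz_zero h hl).symm
  | succ j ih => show E j (D j (sh x)) = _; rw [ih, E_zz h hl]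

theorem zf_main {x : Pth} (h : Valid x) (hl : Lat x) (l : ℕ) (hx : ∀ i m, l ≤ i → x i m = 0) :
    (∀ m, rho x m < l) ∧ Valid (zf x) ∧ Lat (zf x) ∧ (∀ i m, l ≤ i → zf x i m = 0) ∧
      R (l+1) (sh x) = zf x := by
  have hr : ∀ m, rho x m < l := by
    intro m
    by_contra hc
    have := rho_inv h hl m
    rw [hx _ _ (by omega), hx _ _ (by omega)] at this
    omega
  have e : D l (sh x) = zf x := by
    rw [D_zz h hl]
    funext i m
    have := hr m
    simp only [zz, zf]
    rw [min_eq_left (by omega)]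
  have v : Valid (zf x) := e ▸ h.sh.D l
  have lt : Lat (zf x) := by
    intro i m
    have h1 := hl i (m+1)
    have h2 := rho_inv h hl m
    simp only [zf]
    split_ifs with a b b
    · omega
    · omega
    · rw [← b] at h2; omega
    · omega
  refine ⟨hr, v, lt, ?_, ?_⟩
  · intro i m hi
    have := hr m
    simp only [zf, hx i _ hi]
    rw [if_neg (by omega)]; rfl
  · rw [← R_D h.sh (l+1) l (by omega), e, R_fix v lt]

end Pit

namespace Pit

structure Good (l : ℕ) (T : ℕ × ℕ → ℕ) (x : Pth) : Prop where
  out : ∀ i j, l ≤ i → T (i, j) = 0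
  rel : ∀ i j m, i < l → (T (i, j) ≤ m ↔ (j : ℤ) < x i m)
  xout : ∀ i m, l ≤ i → x i m = 0
  v : Valid x
  lat : Lat x

theorem Good.entry {l : ℕ} {T : ℕ × ℕ → ℕ} {x : Pth} (g : Good l T x) {i j m : ℕ} (hi : i < l)
    (h : T (i, j) = m + 1) : x i (m+1) = j + 1 ∧ x i m = j := by
  have h1 := (g.rel i j (m+1) hi).1 (by omega)
  have h2 := mt (g.rel i j m hi).2 (by omega)
  obtain ⟨a, ha⟩ := g.v.step m
  have := ha i
  split_ifs at this <;> omega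

theorem Good.tpos {l : ℕ} {T : ℕ × ℕ → ℕ} {x : Pth} (g : Good l T x) {i j : ℕ} (hi : i < l) :
    0 < T (i, j) := by
  by_contra hc
  have := (g.rel i j 0 hi).1 (by omega)
  rw [g.v.zero] at this
  omega

theorem Good.row {l : ℕ} {T : ℕ × ℕ → ℕ} {x : Pth} (g : Good l T x) {i j : ℕ} (hi : i < l) :
    T (i, j) < T (i, j + 1) := by
  have h0 := g.tpos (j := j + 1) hi
  obtain ⟨m, hm⟩ : ∃ m, T (i, j+1) = m + 1 := ⟨T (i, j+1) - 1, by omega⟩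
  have h1 := g.entry hi hm
  have := (g.rel i j m hi).2 (by push_cast at h1; omega)
  omega

theorem Good.col {l : ℕ} {T : ℕ × ℕ → ℕ} {x : Pth} (g : Good l T x) {i j : ℕ} (hi : i + 1 < l) :
    T (i, j) < T (i + 1, j) := by
  have h0 := g.tpos (j := j) hi
  obtain ⟨m, hm⟩ : ∃ m, T (i+1, j) = m + 1 := ⟨T (i+1, j) - 1, by omega⟩
  have h1 := g.entry hi hm
  obtain ⟨a, ha⟩ := g.v.step m
  have h2 := ha i
  have h3 := ha (i+1)
  have h4 := g.lat i (m+1)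
  have h5 := g.lat i m
  have := (g.rel i j m (by omega)).2 (by split_ifs at h2 h3 <;> omega)
  omega

theorem box_iff (l : ℕ) (i j : ℕ) : Box (l : ℕ∞) (i, j) ↔ i < l := by
  simp [Box]

theorem slide_step {l : ℕ} (T : ℕ × ℕ → ℕ) {n i j : ℕ}
    (hs : slide (Box (l : ℕ∞)) T n = (i, j)) (hi : i < l) :
    (slide (Box (l : ℕ∞)) T (n+1) = (i, j+1) ∨
      (i + 1 < l ∧ slide (Box (l : ℕ∞)) T (n+1) = (i+1, j))) ∧
    T (slide (Box (l : ℕ∞)) T (n+1)) ≤ T (i, j+1) ∧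
    (i + 1 < l → T (slide (Box (l : ℕ∞)) T (n+1)) ≤ T (i+1, j)) := by
  unfold slide at *
  have e : slideFrom (Box (l : ℕ∞)) T (0, 0) (n+1) =
      if i + 1 < l ∧ i < l then (if T (i+1, j) < T (i, j+1) then (i+1, j) else (i, j+1))
      else if i + 1 < l then (i+1, j) else if i < l then (i, j+1) else (i, j) := by
    simp only [slideFrom, hs, box_iff]
  rw [e]
  split_ifs <;> simp <;> omega

theorem slide_in {l : ℕ} (hl : 1 ≤ l) (T : ℕ × ℕ → ℕ) (n : ℕ) :
    ∃ i j, slide (Box (l : ℕ∞)) T n = (i, j) ∧ i < l ∧ i + j = n := by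
  induction n with
  | zero => exact ⟨0, 0, rfl, by omega, rfl⟩
  | succ n ih =>
    obtain ⟨i, j, e, h, h'⟩ := ih
    rcases (slide_step T e h).1 with h1 | ⟨h0, h1⟩
    · exact ⟨i, j+1, h1, h, by omega⟩
    · exact ⟨i+1, j, h1, h0, by omega⟩

theorem Good.slide_lt {l : ℕ} (hl : 1 ≤ l) {T : ℕ × ℕ → ℕ} {x : Pth} (g : Good l T x) (n : ℕ) :
    T (slide (Box (l : ℕ∞)) T n) < T (slide (Box (l : ℕ∞)) T (n+1)) := by
  obtain ⟨i, j, e, h, h'⟩ := slide_in hl T n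
  rcases (slide_step T e h).1 with h1 | ⟨h0, h1⟩
  · rw [e, h1]; exact g.row h
  · rw [e, h1]; exact g.col h0

theorem Good.track {l : ℕ} (hl : 1 ≤ l) {T : ℕ × ℕ → ℕ} {x : Pth} (g : Good l T x) (m : ℕ) :
    ∃ n j, slide (Box (l : ℕ∞)) T n = (rho x m, j) ∧ x (rho x m) (m+1) = j + 1 ∧
      m + 1 < T (slide (Box (l : ℕ∞)) T (n+1)) := by
  have hr := (zf_main g.v g.lat l g.xout).1
  induction m with
  | zero =>
    refine ⟨0, 0, rfl, ?_, ?_⟩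
    · have h0 := rho_inv g.v g.lat 0
      have h3 := (zf_main g.v g.lat l g.xout).2.1.zero 0
      simp only [zf, rho] at h3
      simp only [rho]
      simp at h3
      simp
      omega
    · have h1 := g.slide_lt hl 0
      have h2 : 0 < T (slide (Box (l : ℕ∞)) T 0) := g.tpos (by omega)
      omega
  | succ m ih =>
    obtain ⟨n, j, hs, hx, ht⟩ := ih
    have hi := hr m
    obtain ⟨s1, s2, s3⟩ := slide_step T hs hi
    obtain ⟨a, ha⟩ := g.v.step (m+1)
    have a1 := ha (rho x m)
    have a2 := ha (rho x m + 1)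
    have e : m + 1 + 1 = m + 2 := rfl
    rw [e] at *
    rcases Nat.lt_or_ge (m+2) (T (slide (Box (l : ℕ∞)) T (n+1))) with h1 | h1
    · have b1 : x (rho x m) (m+2) = j + 1 := by
        by_contra hc
        have := (g.rel (rho x m) (j+1) (m+2) hi).2 (by push_cast; split_ifs at a1 <;> omega)
        omega
      have b2 : rho x (m+1) = rho x m := by
        rw [rho]
        rw [if_neg]
        rintro ⟨c1, c2⟩
        rcases Nat.lt_or_ge (rho x m + 1) l with c3 | c3
        · have := (g.rel (rho x m + 1) j (m+2) c3).2 (by omega)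
          have := s3 c3
          omega
        · have := g.xout _ (m+2) c3
          have := g.xout _ (m+1) c3
          omega
      rw [b2]
      exact ⟨n, j, hs, b1, h1⟩
    · have h2 : T (slide (Box (l : ℕ∞)) T (n+1)) = m + 1 + 1 := by omega
      have h3 := g.slide_lt hl (n+1)
      rcases s1 with s1 | ⟨s0, s1⟩
      · rw [s1] at h2
        have h4 := g.entry hi h2
        have b2 : rho x (m+1) = rho x m := by
          rw [rho]
          rw [if_neg]
          rintro ⟨c1, c2⟩
          rw [e] at h4
          push_cast at h4
          split_ifs at a1 a2 <;> omega
        rw [b2]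
        refine ⟨n+1, j+1, s1, ?_, ?_⟩
        · exact h4.1
        · rw [s1] at h3; omega
      · rw [s1] at h2
        have h4 := g.entry s0 h2
        rw [e] at h4
        have b2 : rho x (m+1) = rho x m + 1 := by
          rw [rho]
          rw [if_pos]
          split_ifs at a1 a2 <;> omega
        rw [b2]
        refine ⟨n+1, j, s1, ?_, ?_⟩
        · exact h4.1
        · rw [s1] at h3; omega

theorem Good.jdt {l : ℕ} (hl : 1 ≤ l) {T : ℕ × ℕ → ℕ} {x : Pth} (g : Good l T x) :
    Good l (jdt (Box (l : ℕ∞)) T) (zf x) := by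
  obtain ⟨hr, v, lt, hz, -⟩ := zf_main g.v g.lat l g.xout
  refine ⟨?_, ?_, hz, v, lt⟩
  · intro i j hi
    obtain ⟨i', j', e, h, -⟩ := slide_in hl T (i+j)
    unfold _root_.jdt
    rw [if_neg]
    · rw [g.out i j hi]
    · simp only
      rw [e]
      intro hh
      have := congrArg Prod.fst hh
      simp at this
      omega
  · intro i j m hi
    have smono : StrictMono (fun n => T (slide (Box (l : ℕ∞)) T n)) :=
      strictMono_nat_of_lt_succ (g.slide_lt hl)
    obtain ⟨n, j', ts, tx, tt⟩ := g.track hl m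
    obtain ⟨i1, j1, e1, -, h1⟩ := slide_in hl T n
    have hn : rho x m + j' = n := by
      rw [ts] at e1
      have p := congrArg Prod.fst e1
      have q := congrArg Prod.snd e1
      simp at p q
      omega
    have tle : T (slide (Box (l : ℕ∞)) T n) ≤ m + 1 := by
      rw [ts]; exact (g.rel _ _ _ (hr m)).2 (by omega)
    have hrel := g.rel i j (m+1) hi
    unfold _root_.jdt
    simp only
    by_cases hs : slide (Box (l : ℕ∞)) T (i+j) = (i, j)
    · rw [if_pos hs]
      obtain ⟨s1, s2, s3⟩ := slide_step T hs hi
      have hne : slide (Box (l : ℕ∞)) T (i+j+1) ≠ (i, j) := by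
        rcases s1 with s1 | ⟨-, s1⟩ <;> rw [s1] <;> simp
      rw [if_neg hne]
      have hlt := g.slide_lt hl (i+j)
      simp only [zf]
      constructor
      · intro hle
        have hle : T (slide (Box (l : ℕ∞)) T (i+j+1)) ≤ m + 1 := by omega
        rcases s1 with s1 | ⟨s0, s1⟩
        · rw [s1] at hle
          have := (g.rel i (j+1) (m+1) hi).1 hle
          push_cast at this
          split_ifs <;> omega
        · have hj := hrel.1 (by rw [hs] at hlt; omega)
          rw [if_neg]
          · omega
          · intro hh
            have h5 : i + j + 1 ≤ n := by
              by_contra hc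
              have := smono.monotone (show n + 1 ≤ i + j + 1 by omega)
              omega
            have h6 : (j' : ℤ) + 1 = x i (m+1) := by rw [hh]; omega
            rw [s1] at hle
            -- row of slide is monotone
            have h7 : ∀ d, ∃ i2 j2, slide (Box (l : ℕ∞)) T (i+j+1+d) = (i2, j2) ∧ i + 1 ≤ i2 ∧
                i2 < l := by
              intro d
              induction d with
              | zero => exact ⟨i+1, j, s1, le_refl _, s0⟩
              | succ d ih =>
                obtain ⟨i2, j2, f1, f2, f3⟩ := ih
                rcases (slide_step T f1 f3).1 with f4 | ⟨f5, f4⟩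
                · exact ⟨i2, _, f4, f2, f3⟩
                · exact ⟨i2+1, _, f4, by omega, f5⟩
            obtain ⟨i2, j2, f1, f2, f3⟩ := h7 (n - (i+j+1))
            rw [show i + j + 1 + (n - (i+j+1)) = n by omega, ts] at f1
            have p := congrArg Prod.fst f1
            simp at p
            omega
      · intro hlt2
        by_contra hc
        have hc : m + 1 < T (slide (Box (l : ℕ∞)) T (i+j+1)) := by omega
        have h5 : T (i, j) ≤ m + 1 := hrel.2 (by split_ifs at hlt2 <;> omega)
        have h6 : n = i + j := by
          apply le_antisymm
          · by_contra hh
            have := smono.monotone (show i + j + 1 ≤ n by omega)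
            omega
          · by_contra hh
            have := smono.monotone (show n + 1 ≤ i + j by omega)
            simp only [hs] at this
            omega
        rw [h6, hs] at ts
        have p := congrArg Prod.fst ts
        have q := congrArg Prod.snd ts
        simp at p q
        rw [← p] at tx
        rw [if_pos p] at hlt2
        omega
    · rw [if_neg hs]
      simp only [zf]
      have : T (i, j) - 1 ≤ m ↔ T (i, j) ≤ m + 1 := by omega
      rw [this, hrel]
      split_ifs with hh
      · constructor
        · intro h3
          by_contra hc
          apply hs
          rw [← hh] at tx ts hn
          obtain rfl : j = j' := by omega
          rw [hn, ts]
        · intro h3; omega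
      · simp

theorem Good.iter {l : ℕ} (hl : 1 ≤ l) {T : ℕ × ℕ → ℕ} {x : Pth} (g : Good l T x) (n : ℕ) :
    Good l ((_root_.jdt (Box (l : ℕ∞)))^[n] T) (R (l+1) (sh^[n] x)) ∧ Valid (sh^[n] x) := by
  induction n with
  | zero =>
    simp only [Function.iterate_zero, id]
    rw [R_fix g.v g.lat]
    exact ⟨g, g.v⟩
  | succ n ih =>
    obtain ⟨ih, hv⟩ := ih
    rw [Function.iterate_succ_apply', Function.iterate_succ_apply']
    refine ⟨?_, hv.sh⟩
    have h1 := ih.jdt hl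
    rw [← (zf_main ih.v ih.lat l ih.xout).2.2.2.2, R_sh_R hv _ _ (le_refl _)] at h1
    exact h1

theorem Good.unique {l : ℕ} {T T' : ℕ × ℕ → ℕ} {x : Pth} (g : Good l T x) (g' : Good l T' x) :
    T = T' := by
  funext ⟨i, j⟩
  rcases Nat.lt_or_ge i l with h | h
  · refine eq_of_forall_ge_iff fun c => ?_
    rw [g.rel i j c h, g'.rel i j c h]
  · rw [g.out i j h, g'.out i j h]

theorem sh_iter {x : Pth} (n i m : ℕ) (h : Valid x) : sh^[n] x i m = x i (m+n) - x i n := by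
  induction n generalizing m with
  | zero => simp [h.zero]
  | succ n ih =>
    rw [Function.iterate_succ_apply']
    simp only [sh]
    rw [ih, ih, show m + 1 + n = m + (n+1) by omega, show 1 + n = n + 1 by omega]
    ring

theorem exists_good {l : ℕ} {T : ℕ × ℕ → ℕ} (h : IsSYT (l : ℕ∞) T) : ∃ x, Good l T x := by
  have hmono : ∀ i, i < l → StrictMono (fun j => T (i, j)) := fun i hi =>
    strictMono_nat_of_lt_succ fun j => h.row_lt (i, j) ((box_iff _ _ _).2 hi)
  have ex : ∀ i m, ∃ N : ℕ, (i < l → ∀ j, T (i, j) ≤ m ↔ j < N) ∧ (l ≤ i → N = 0) := by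
    intro i m
    rcases Nat.lt_or_ge i l with hi | hi
    · have hex : ∃ j, m < T (i, j) := by
        refine ⟨m+1, ?_⟩
        have := (hmono i hi).le_apply (x := m+1)
        omega
      refine ⟨Nat.find hex, fun _ j => ?_, fun _ => by omega⟩
      constructor
      · intro hj
        by_contra hc
        have h1 := Nat.find_spec hex
        have h2 := (hmono i hi).monotone (show Nat.find hex ≤ j by omega)
        omega
      · intro hj
        have := Nat.find_min hex hj
        omega
    · exact ⟨0, by omega, by simp⟩
  choose N hN hN0 using ex
  refine ⟨fun i m => (N i m : ℤ), ?_⟩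
  have hrel : ∀ i j m, i < l → (T (i, j) ≤ m ↔ j < N i m) := fun i j m hi => hN i m hi j
  refine ⟨?_, ?_, ?_, ⟨?_, ?_⟩, ?_⟩
  · intro i j hi
    exact h.zero_outside _ (by rw [box_iff]; omega)
  · intro i j m hi
    rw [hrel i j m hi]; omega
  · intro i m hi
    simp [hN0 i m hi]
  · intro i
    rcases Nat.lt_or_ge i l with hi | hi
    · have h1 := h.pos (i, 0) ((box_iff _ _ _).2 hi)
      have := mt (hrel i 0 0 hi).2 (by omega)
      omega
    · simp [hN0 i 0 hi]
  · intro m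
    obtain ⟨⟨a, b⟩, hb, hT⟩ := h.surj (m+1) (by omega)
    rw [box_iff] at hb
    refine ⟨a, fun i => ?_⟩
    rcases Nat.lt_or_ge i l with hi | hi
    · split_ifs with hia
      · subst hia
        have h1 := (hrel i b (m+1) hi).1 (by omega)
        have h2 := mt (hrel i b m hi).2 (by omega)
        have h3 := hmono i hi (show b < b + 1 by omega)
        simp only at h3
        have h4 := mt (hrel i (b+1) (m+1) hi).2 (by omega)
        have h5 : b ≤ N i m := by
          by_contra hc
          have h6 := hmono i hi (show N i m < b by omega)
          simp only at h6
          have := (hrel i (N i m) m hi).1 (by omega)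
          omega
        omega
      · have : N i (m+1) = N i m := by
          refine eq_of_forall_lt_iff fun j => ?_
          rw [← hrel i j (m+1) hi, ← hrel i j m hi]
          have : T (i, j) ≠ m + 1 := by
            intro hh
            have := h.inj (i, j) (a, b) ((box_iff _ _ _).2 hi) ((box_iff _ _ _).2 hb) (by omega)
            exact hia (congrArg Prod.fst this)
          omega
        omega
    · rw [hN0 i _ hi, hN0 i _ hi, if_neg (by omega)]; simp
  · intro i m
    simp only
    rcases Nat.lt_or_ge (i+1) l with hi | hi
    · by_contra hc
      have h1 := (hrel (i+1) (N i m) m hi).2 (by omega)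
      have h2 := h.col_lt (i, N i m) ((box_iff _ _ _).2 hi)
      have := (hrel i (N i m) m (by omega)).1 (by simp only at h2; omega)
      omega
    · rw [hN0 _ m hi]; simp

end Pit

namespace Pit

theorem sig_pos {l : ℕ} (hl : 1 ≤ l) {nu lamh : ℕ → ℕ}
    (hwd : WeaklyDecreasing nu lamh) (hht : SkewHeight nu lamh l) {i : ℕ} (hi : i < l) :
    0 < lamh i - nu i := by
  have anti : Antitone (fun i => lamh i - nu i) := antitone_nat_of_succ_le hwd
  have h1 := anti (show i ≤ l - 1 by omega)
  have h2 := hht.1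
  simp only at h1
  omega

theorem skew_in {nu lamh : ℕ → ℕ} {i a : ℕ} (h : a < lamh i - nu i) :
    SkewBox nu lamh (i, nu i + a) := by
  constructor <;> simp only <;> omega

theorem smash_B {l k n : ℕ} {nu lamh lam : ℕ → ℕ} {S B : ℕ × ℕ → ℕ} {i j : ℕ} (hi : i < l)
    (hj : j < lam i) : smashInf (l : ℕ∞) n k lam B nu lamh S (i, j) = B (i, j) := by
  unfold smashInf
  rw [if_pos ((box_iff _ _ _).2 hi), if_pos hj]

theorem smash_S {l k n : ℕ} {nu lamh lam : ℕ → ℕ} {S B : ℕ × ℕ → ℕ} {i c a : ℕ} (hi : i < l)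
    (ha : a < lamh i - nu i) :
    smashInf (l : ℕ∞) n k lam B nu lamh S (i, lam i + c * (lamh i - nu i) + a) =
      S (i, nu i + a) + n + c * k := by
  unfold smashInf
  rw [if_pos ((box_iff _ _ _).2 hi), if_neg (by simp only; omega)]
  simp only
  have e : lam i + c * (lamh i - nu i) + a - lam i = a + (lamh i - nu i) * c := by
    rw [mul_comm]; omega
  rw [e, Nat.add_mul_mod_self_left, Nat.mod_eq_of_lt ha,
    Nat.add_mul_div_left _ _ (by omega), Nat.div_eq_of_lt ha, zero_add]

theorem decomp {s p j : ℕ} (hs : 0 < s) (hj : p ≤ j) : ∃ c a, a < s ∧ j = p + c * s + a := by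
  refine ⟨(j - p) / s, (j - p) % s, Nat.mod_lt _ hs, ?_⟩
  have := Nat.div_add_mod (j - p) s
  rw [mul_comm] at this
  omega

theorem S_mono {nu lamh : ℕ → ℕ} {k : ℕ} {S : ℕ × ℕ → ℕ} (hS : IsSkewSYT nu lamh k S) {i a b : ℕ}
    (hab : a ≤ b) (hb : b < lamh i - nu i) : S (i, nu i + a) ≤ S (i, nu i + b) := by
  induction b with
  | zero => obtain rfl : a = 0 := by omega
            exact le_refl _
  | succ b ih =>
    rcases Nat.lt_or_ge b a with h | h
    · obtain rfl : a = b + 1 := by omega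
      exact le_refl _
    · have h1 := ih h (by omega)
      have h2 := hS.row_lt (i, nu i + b) (skew_in (by omega)) (skew_in (a := b + 1) hb)
      simp only at h2
      have e : nu i + b + 1 = nu i + (b + 1) := rfl
      rw [e] at h2
      omega

theorem smash_per (l k n : ℕ) (hl : 1 ≤ l)
    (nu lamh : ℕ → ℕ)
    (hwd : WeaklyDecreasing nu lamh) (hht : SkewHeight nu lamh l)
    (S : ℕ × ℕ → ℕ) (hS : IsSkewSYT nu lamh k S)
    (lam : ℕ → ℕ)
    (B : ℕ × ℕ → ℕ) (hB : IsFinSYT lam n B) (i : ℕ) (hi : i < l) (j m : ℕ) :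
    smashInf (l : ℕ∞) n k lam B nu lamh S (i, j) ≤ m + n + k ↔
      (j < lamh i - nu i ∨ ∃ j', j = j' + (lamh i - nu i) ∧
        smashInf (l : ℕ∞) n k lam B nu lamh S (i, j') ≤ m + n) := by
  have hs := sig_pos hl hwd hht hi
  have small : ∀ j, j < lam i → smashInf (l : ℕ∞) n k lam B nu lamh S (i, j) ≤ n := by
    intro j hj
    rw [smash_B hi hj]; exact hB.ub _ hj
  rcases Nat.lt_or_ge j (lam i) with h | h
  · have h1 := small j h
    refine iff_of_true (by omega) ?_
    rcases Nat.lt_or_ge j (lamh i - nu i) with h2 | h2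
    · exact Or.inl h2
    · refine Or.inr ⟨j - (lamh i - nu i), by omega, ?_⟩
      have := small (j - (lamh i - nu i)) (by omega)
      omega
  · obtain ⟨c, a, ha, rfl⟩ := decomp hs h
    cases c with
    | zero =>
      rw [smash_S hi ha]
      have := hS.ub _ (skew_in ha)
      refine iff_of_true (by omega) ?_
      rcases Nat.lt_or_ge (lam i + 0 * (lamh i - nu i) + a) (lamh i - nu i) with h2 | h2
      · exact Or.inl h2
      · refine Or.inr ⟨lam i + 0 * (lamh i - nu i) + a - (lamh i - nu i), by omega, ?_⟩
        have := small (lam i + 0 * (lamh i - nu i) + a - (lamh i - nu i)) (by omega)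
        omega
    | succ c =>
      rw [smash_S hi ha]
      have e : lam i + (c+1) * (lamh i - nu i) + a
        = lam i + c * (lamh i - nu i) + a + (lamh i - nu i) := by ring
      have e2 : (c+1) * k = c * k + k := by ring
      rw [e]
      constructor
      · intro h1
        refine Or.inr ⟨_, rfl, ?_⟩
        rw [smash_S hi ha]
        omega
      · rintro (h1 | ⟨j', h1, h2⟩)
        · omega
        · obtain rfl : lam i + c * (lamh i - nu i) + a = j' := by omega
          rw [smash_S hi ha] at h2
          omega

theorem smash_syt (l k n : ℕ) (hl : 1 ≤ l) (hk : 1 ≤ k) (hn : 1 ≤ n)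
    (nu lamh : ℕ → ℕ) (hshape : IsSkewShape nu lamh k)
    (hwd : WeaklyDecreasing nu lamh) (hht : SkewHeight nu lamh l)
    (S : ℕ × ℕ → ℕ) (hS : IsSkewSYT nu lamh k S)
    (lam : ℕ → ℕ) (hpart : IsPartition lam n) (hrows : ∀ i : ℕ, l ≤ i → lam i = 0)
    (B : ℕ × ℕ → ℕ) (hB : IsFinSYT lam n B)
    (hstd : BSstandard l n lam nu lamh B S) :
    IsSYT (l : ℕ∞) (smashInf (l : ℕ∞) n k lam B nu lamh S) := by
  have hs : ∀ i, i < l → 0 < lamh i - nu i := fun i hi => sig_pos hl hwd hht hi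
  have cases' : ∀ i j, i < l → (j < lam i ∧ smashInf (l : ℕ∞) n k lam B nu lamh S (i, j) = B (i, j) ∧
      1 ≤ B (i, j) ∧ B (i, j) ≤ n) ∨
      ∃ c a, a < lamh i - nu i ∧ j = lam i + c * (lamh i - nu i) + a ∧
        smashInf (l : ℕ∞) n k lam B nu lamh S (i, j) = S (i, nu i + a) + n + c * k ∧
        1 ≤ S (i, nu i + a) ∧ S (i, nu i + a) ≤ k := by
    intro i j hi
    rcases Nat.lt_or_ge j (lam i) with h | h
    · exact Or.inl ⟨h, smash_B hi h, hB.lb _ h, hB.ub _ h⟩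
    · obtain ⟨c, a, ha, rfl⟩ := decomp (hs i hi) h
      exact Or.inr ⟨c, a, ha, rfl, smash_S hi ha, hS.lb _ (skew_in ha), hS.ub _ (skew_in ha)⟩
  constructor
  · intro b hb
    unfold smashInf
    rw [if_neg hb]
  · rintro ⟨i, j⟩ hb
    rw [box_iff] at hb
    rcases cases' i j hb with ⟨_, h, h1, _⟩ | ⟨c, a, _, _, h, h1, _⟩ <;> rw [h] <;> omega
  · rintro ⟨i, j⟩ ⟨i', j'⟩ hb hb' heq
    rw [box_iff] at hb hb'
    rcases cases' i j hb with ⟨h0, h, h1, h2⟩ | ⟨c, a, h0, hj, h, h1, h2⟩ <;>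
    rcases cases' i' j' hb' with ⟨h0', h', h1', h2'⟩ | ⟨c', a', h0', hj', h', h1', h2'⟩ <;>
    rw [h, h'] at heq
    · exact hB.inj _ _ h0 h0' heq
    · omega
    · omega
    · have hc : c = c' := by
        rcases Nat.lt_trichotomy c c' with q | q | q
        · have := Nat.mul_le_mul_right k (show c + 1 ≤ c' from q)
          have e2 : (c+1) * k = c * k + k := by ring
          omega
        · exact q
        · have := Nat.mul_le_mul_right k (show c' + 1 ≤ c from q)
          have e2 : (c'+1) * k = c' * k + k := by ring
          omega
      subst hc
      have := hS.inj _ _ (skew_in h0) (skew_in h0') (by omega)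
      have p := congrArg Prod.fst this
      have q := congrArg Prod.snd this
      simp only at p q
      subst p
      obtain rfl : a = a' := by omega
      rw [hj, hj']
  · intro m hm
    rcases Nat.lt_or_ge n m with h | h
    · have hm2 := Nat.div_add_mod (m - n - 1) k
      have hm3 := Nat.mod_lt (m - n - 1) (show 0 < k by omega)
      obtain ⟨⟨i, j⟩, ⟨h1, h2⟩, h3⟩ := hS.surj ((m - n - 1) % k + 1) (by omega) (by omega)
      simp only at h1 h2
      have hi : i < l := by
        by_contra hc
        have := hht.2 i (by omega)
        omega
      refine ⟨(i, lam i + ((m - n - 1) / k) * (lamh i - nu i) + (j - nu i)),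
        (box_iff _ _ _).2 hi, ?_⟩
      rw [smash_S hi (by omega), show nu i + (j - nu i) = j by omega, h3]
      rw [mul_comm] at hm2
      omega
    · obtain ⟨⟨i, j⟩, h1, h2⟩ := hB.surj m hm h
      have hi : i < l := by
        by_contra hc
        have := hrows i (by omega)
        unfold YBox at h1
        simp only at h1
        omega
      exact ⟨(i, j), (box_iff _ _ _).2 hi, by rw [smash_B hi h1, h2]⟩
  · rintro ⟨i, j⟩ hb
    rw [box_iff] at hb
    simp only
    rcases Nat.lt_or_ge j (lam i) with h | h
    · rcases Nat.lt_or_ge (j+1) (lam i) with h3 | h3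
      · rw [smash_B hb h, smash_B hb h3]
        exact hB.row_lt (i, j) h3
      · rw [smash_B hb h]
        have := hB.ub (i, j) h
        rcases cases' i (j+1) hb with ⟨h0, _⟩ | ⟨c, a, h0, hj, h, h1, h2⟩
        · omega
        · omega
    · obtain ⟨c, a, ha, rfl⟩ := decomp (hs i hb) h
      rw [smash_S hb ha]
      rcases Nat.lt_or_ge (a+1) (lamh i - nu i) with h3 | h3
      · rw [show lam i + c * (lamh i - nu i) + a + 1 = lam i + c * (lamh i - nu i) + (a + 1) from rfl,
          smash_S hb h3]
        have h2 := hS.row_lt (i, nu i + a) (skew_in ha) (skew_in (a := a + 1) h3)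
        simp only at h2
        have e : nu i + a + 1 = nu i + (a + 1) := rfl
        rw [e] at h2
        omega
      · have e : lam i + c * (lamh i - nu i) + a + 1 = lam i + (c+1) * (lamh i - nu i) + 0 := by
          have : (c+1) * (lamh i - nu i) = c * (lamh i - nu i) + (lamh i - nu i) := by ring
          omega
        rw [e, smash_S hb (hs i hb)]
        have h1 := hS.ub _ (skew_in ha)
        have h2 := hS.lb _ (skew_in (hs i hb))
        have e2 : (c+1) * k = c * k + k := by ring
        omega
  · rintro ⟨i, j⟩ hb
    rw [box_iff] at hb
    simp only at hb ⊢
    have hi : i < l := by omega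
    have hlam := hpart.antitone i
    have hsig := hwd i
    rcases cases' (i+1) j hb with ⟨h0, h, h1, h2⟩ | ⟨c', a', h0', hj', h', h1', h2'⟩
    · rw [h, smash_B hi (by omega)]
      exact hB.col_lt (i, j) h0
    · rcases cases' i j hi with ⟨h0, h, h1, h2⟩ | ⟨c, a, h0, hj, h, h1, h2⟩
      · omega
      · rw [h, h']
        rcases Nat.lt_trichotomy c c' with q | q | q
        · have := Nat.mul_le_mul_right k (show c + 1 ≤ c' from q)
          have e2 : (c+1) * k = c * k + k := by ring
          omega
        · subst q
          have hm := Nat.mul_le_mul_left c hsig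
          have key := hstd.2 i (lam i + a) (by simp only [if_pos hi]; omega)
            (by simp only [if_pos hb]; omega)
          beta_reduce at key
          rw [if_neg (by simp only; omega), if_neg (by simp only; omega)] at key
          simp only at key
          rw [show lam i + a - lam i = a by omega] at key
          have := S_mono hS (i := i+1) (show lam i + a - lam (i+1) ≤ a' by omega) h0'
          omega
        · have a1 := Nat.mul_le_mul_right (lamh (i+1) - nu (i+1)) (show c' + 1 ≤ c from q)
          have a2 := Nat.mul_le_mul_left c hsig
          have e2 : (c'+1) * (lamh (i+1) - nu (i+1)) =
            c' * (lamh (i+1) - nu (i+1)) + (lamh (i+1) - nu (i+1)) := by ring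
          omega

end Pit

/-- Let `σ = λ̂/ν` be a weakly decreasing skew shape contained in `(∞^l)` with
`ℓ(σ) = l` and `|σ| = k`, let `S` be a standard skew Young tableau of shape `σ`,
let `B` be a standard Young tableau of a shape `lam ⊢ n` with at most `l` rows
such that `B ◁ S` is a standard filling.  Then the iterated left smash
`T = B ◁ S ◁ S ◁ ⋯` is an infinite standard Young tableau of shape `(∞^l)` and
`jdt^n(T)` is `k`-periodic, i.e. `jdt^{n+k}(T) = jdt^n(T)`. -/
theorem stmt_10 (l k n : ℕ) (hl : 1 ≤ l) (hk : 1 ≤ k) (hn : 1 ≤ n)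
    (nu lamh : ℕ → ℕ) (hshape : IsSkewShape nu lamh k)
    (hwd : WeaklyDecreasing nu lamh) (hht : SkewHeight nu lamh l)
    (S : ℕ × ℕ → ℕ) (hS : IsSkewSYT nu lamh k S)
    (lam : ℕ → ℕ) (hpart : IsPartition lam n) (hrows : ∀ i : ℕ, l ≤ i → lam i = 0)
    (B : ℕ × ℕ → ℕ) (hB : IsFinSYT lam n B)
    (hstd : BSstandard l n lam nu lamh B S) :
    IsSYT (l : ℕ∞) (smashInf (l : ℕ∞) n k lam B nu lamh S) ∧
    (jdt (Box (l : ℕ∞)))^[n + k] (smashInf (l : ℕ∞) n k lam B nu lamh S) =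
      (jdt (Box (l : ℕ∞)))^[n] (smashInf (l : ℕ∞) n k lam B nu lamh S) := by
  have hsyt := Pit.smash_syt l k n hl hk hn nu lamh hshape hwd hht S hS lam hpart hrows B hB hstd
  refine ⟨hsyt, ?_⟩
  obtain ⟨x, g⟩ := Pit.exists_good hsyt
  have hsh : Pit.sh^[n+k] x = Pit.sh^[n] x := by
    funext i m
    rw [Pit.sh_iter _ _ _ g.v, Pit.sh_iter _ _ _ g.v]
    rcases Nat.lt_or_ge i l with hi | hi
    · have key := Pit.smash_per l k n hl nu lamh hwd hht S hS lam B hB i hi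
      have hx : ∀ m, x i (m + n + k) = x i (m + n) + ((lamh i - nu i : ℕ) : ℤ) := by
        intro m
        have hnn : ∀ m, 0 ≤ x i m := by
          intro m
          induction m with
          | zero => rw [g.v.zero]
          | succ m ih =>
            obtain ⟨a, ha⟩ := g.v.step m
            rw [ha]
            split_ifs <;> omega
        have h1 := hnn (m+n+k)
        have h2 := hnn (m+n)
        have h3 : ∀ j : ℕ, (j : ℤ) < x i (m+n+k) ↔ (j : ℤ) < x i (m + n) + ((lamh i - nu i : ℕ) : ℤ) := by
          intro j
          rw [← g.rel i j _ hi, key j m]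
          constructor
          · rintro (h | ⟨j', rfl, h⟩)
            · omega
            · rw [g.rel i j' _ hi] at h
              push_cast
              omega
          · intro h
            rcases Nat.lt_or_ge j (lamh i - nu i) with h4 | h4
            · exact Or.inl h4
            · refine Or.inr ⟨j - (lamh i - nu i), by omega, ?_⟩
              rw [g.rel i _ _ hi]
              omega
        have h4 := h3 (x i (m+n+k)).toNat
        have h5 := h3 (x i (m+n) + ((lamh i - nu i : ℕ) : ℤ)).toNat
        omega
      have h0 := hx 0
      have h1 := hx m
      rw [show 0 + n + k = n + k by omega, zero_add] at h0
      rw [show m + (n + k) = m + n + k by omega]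
      omega
    · simp [g.xout i _ hi]
  have g1 := (g.iter hl (n+k)).1
  have g2 := (g.iter hl n).1
  rw [hsh] at g1
  exact g1.unique g2
end
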